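/- For every single-sink network N on an acyclic directed graph (with right-constant, piecewise constant network inflow rates having finitely many jump points and bounded support), there exists an instantaneous dynamic equilibrium (IDE) flow in N that has only finitely many phases; in particular, all edge inflow and outflow rates of this IDE are piecewise constant functions with finitely many pieces. -/

import Mathlib

open MeasureTheory Set

/-- A walk in a directed graph given by `tail`/`head` maps: `IsWalk tail head v w L`
means the list of edges `L` forms a walk from `v` to `w`. -/
def IsWalk {V E : Type} (tail head : E → V) : V → V → List E → Prop
  | v, w, [] => v = w
  | v, w, e :: L => tail e = v ∧ IsWalk tail head (head e) w L

/-- A right-constant step function with finitely many jump points. -/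
def RightConstantStep (g : ℝ → ℝ) : Prop :=
  ∃ s : Finset ℝ, ∀ x y : ℝ, x ≤ y → (∀ p ∈ s, ¬ (x < p ∧ p ≤ y)) → g x = g y

/-- A single-sink network: a finite directed graph with positive rational capacities
and travel times, a sink reachable from every node, and nonnegative rational-valued
right-constant step network inflow rates (zero at the sink and for negative times). -/
structure Network (V E : Type) [Fintype V] [DecidableEq V] [Fintype E] [DecidableEq E] where
  tail : E → V
  head : E → V
  cap : E → ℝ
  time : E → ℝ
  sink : V
  u : V → ℝ → ℝ
  cap_pos : ∀ e, 0 < cap e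
  cap_rat : ∀ e, ∃ q : ℚ, cap e = (q : ℝ)
  time_pos : ∀ e, 0 < time e
  time_rat : ∀ e, ∃ q : ℚ, time e = (q : ℝ)
  reach : ∀ v, ∃ L : List E, IsWalk tail head v sink L
  u_nonneg : ∀ v θ, 0 ≤ u v θ
  u_rat : ∀ v θ, ∃ q : ℚ, u v θ = (q : ℝ)
  u_sink : ∀ θ, u sink θ = 0
  u_neg : ∀ v θ, θ < 0 → u v θ = 0
  u_step : ∀ v, RightConstantStep (u v)

variable {V E : Type} [Fintype V] [DecidableEq V] [Fintype E] [DecidableEq E]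

/-- The edges leaving a node `v`, i.e. `δ⁺(v)`. -/
def Network.outEdges (N : Network V E) (v : V) : Finset E :=
  Finset.univ.filter (fun e => N.tail e = v)

/-- The edges entering a node `v`, i.e. `δ⁻(v)`. -/
def Network.inEdges (N : Network V E) (v : V) : Finset E :=
  Finset.univ.filter (fun e => N.head e = v)

/-- `τ_min`, the minimal travel time of an edge. -/
noncomputable def Network.tauMin (N : Network V E) : ℝ := sInf (Set.range N.time)

/-- `max_ζ u_v(ζ)`, the maximal network inflow rate at `v`. -/
noncomputable def Network.uMax (N : Network V E) (v : V) : ℝ := ⨆ θ : ℝ, N.u v θ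

/-- The maximal out-degree `Δ` of the network. -/
def Network.maxOutDeg (N : Network V E) : ℕ :=
  Finset.univ.sup (fun v => (N.outEdges v).card)

/-- All network inflow rates have bounded support. -/
def Network.BddInflow (N : Network V E) : Prop :=
  ∀ v, ∃ B : ℝ, ∀ θ, B ≤ θ → N.u v θ = 0

/-- The directed graph of the network is acyclic. -/
def Network.Acyclic (N : Network V E) : Prop :=
  ∀ (v : V) (L : List E), L ≠ [] → ¬ IsWalk N.tail N.head v v L

/-- A flow over time: locally integrable nonnegative edge in- and outflow rates. -/
structure FlowOverTime (N : Network V E) where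
  fplus : E → ℝ → ℝ
  fminus : E → ℝ → ℝ
  fplus_nonneg : ∀ e θ, 0 ≤ fplus e θ
  fminus_nonneg : ∀ e θ, 0 ≤ fminus e θ
  fplus_int : ∀ e θ, IntervalIntegrable (fplus e) volume 0 θ
  fminus_int : ∀ e θ, IntervalIntegrable (fminus e) volume 0 θ

/-- The queue length `q_e(θ) = F⁺_e(θ) − F⁻_e(θ + τ_e)`. -/
noncomputable def queueOf (N : Network V E) (fplus fminus : E → ℝ → ℝ) (e : E) (θ : ℝ) : ℝ :=
  (∫ ζ in (0:ℝ)..θ, fplus e ζ) - ∫ ζ in (0:ℝ)..(θ + N.time e), fminus e ζ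

/-- The instantaneous travel time `c_e(θ) = τ_e + q_e(θ)/ν_e`. -/
noncomputable def ctimeOf (N : Network V E) (fplus fminus : E → ℝ → ℝ) (e : E) (θ : ℝ) : ℝ :=
  N.time e + queueOf N fplus fminus e θ / N.cap e

/-- The node label `ℓ_v(θ)`: the shortest instantaneous travel time from `v` to the sink. -/
noncomputable def labelOf (N : Network V E) (fplus fminus : E → ℝ → ℝ) (v : V) (θ : ℝ) : ℝ :=
  sInf { r : ℝ | ∃ L : List E, IsWalk N.tail N.head v N.sink L ∧
                  r = (L.map (fun e => ctimeOf N fplus fminus e θ)).sum }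

/-- Edge `e` is active at time `θ`: `ℓ_{tail e}(θ) = c_e(θ) + ℓ_{head e}(θ)`. -/
def ActiveOf (N : Network V E) (fplus fminus : E → ℝ → ℝ) (e : E) (θ : ℝ) : Prop :=
  labelOf N fplus fminus (N.tail e) θ =
    ctimeOf N fplus fminus e θ + labelOf N fplus fminus (N.head e) θ

/-- Feasibility of a flow over time: flow conservation (i)/(ii), no outflow before `τ_e`
(iii), and queues operating at capacity (iv). -/
def Feasible (N : Network V E) (f : FlowOverTime N) : Prop :=
  (∀ v, v ≠ N.sink → ∀ θ : ℝ, 0 ≤ θ →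
      (∑ e ∈ N.outEdges v, f.fplus e θ) - (∑ e ∈ N.inEdges v, f.fminus e θ) = N.u v θ) ∧
  (∀ θ : ℝ, 0 ≤ θ →
      (∑ e ∈ N.outEdges N.sink, f.fplus e θ) - (∑ e ∈ N.inEdges N.sink, f.fminus e θ) ≤ 0) ∧
  (∀ e, ∀ θ : ℝ, 0 ≤ θ → θ < N.time e → f.fminus e θ = 0) ∧
  (∀ e, ∀ θ : ℝ, 0 ≤ θ →
      f.fminus e (θ + N.time e) =
        if 0 < queueOf N f.fplus f.fminus e θ then N.cap e
        else min (f.fplus e θ) (N.cap e))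

/-- An instantaneous dynamic equilibrium: a feasible flow that only sends flow
into currently active edges. -/
def IsIDE (N : Network V E) (f : FlowOverTime N) : Prop :=
  Feasible N f ∧
  ∀ e, ∀ θ : ℝ, 0 ≤ θ → 0 < f.fplus e θ → ActiveOf N f.fplus f.fminus e θ

/-- `g` is almost everywhere constant on the set `S`. -/
def AEConstOn (g : ℝ → ℝ) (S : Set ℝ) : Prop :=
  ∃ c : ℝ, ∀ᵐ θ ∂(volume.restrict S), g θ = c

/-- The `i`-th segment of the partition `0 = t 0 < t 1 < ⋯ < t n < ∞`. -/
def phaseSeg (n : ℕ) (t : ℕ → ℝ) (i : ℕ) : Set ℝ :=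
  if i < n then Set.Ioo (t i) (t (i+1)) else Set.Ioi (t n)

/-- `ℝ≥0` splits (up to finitely many points) into the `n+1` intervals given by
`t`, on each of which all edge in- and outflow rates are a.e. constant; i.e. the
flow has at most `n+1` phases. -/
def PhasePartition (N : Network V E) (f : FlowOverTime N) (n : ℕ) (t : ℕ → ℝ) : Prop :=
  t 0 = 0 ∧ (∀ i, i < n → t i < t (i+1)) ∧
  ∀ i, i ≤ n → ∀ e, AEConstOn (f.fplus e) (phaseSeg n t i) ∧ AEConstOn (f.fminus e) (phaseSeg n t i)

/-! ### Piecewise properties of intervals -/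

/-- `P` holds on every subinterval of `[s, t]` whose interior avoids some fixed finite set. -/
def PiecewiseOn (P : ℝ → ℝ → Prop) (s t : ℝ) : Prop :=
  ∃ F : Finset ℝ, ∀ a b, s ≤ a → a < b → b ≤ t → (∀ p ∈ F, ¬ (a < p ∧ p < b)) → P a b

namespace PiecewiseOn

variable {P Q : ℝ → ℝ → Prop} {s t m : ℝ}

theorem mono (h : PiecewiseOn P s t)
    (hPQ : ∀ a b, s ≤ a → a < b → b ≤ t → P a b → Q a b) : PiecewiseOn Q s t := by
  obtain ⟨F, hF⟩ := h
  exact ⟨F, fun a b ha hab hb hp => hPQ a b ha hab hb (hF a b ha hab hb hp)⟩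

theorem mono_interval {s' t' : ℝ} (h : PiecewiseOn P s t) (hs : s ≤ s') (ht : t' ≤ t) :
    PiecewiseOn P s' t' := by
  obtain ⟨F, hF⟩ := h
  exact ⟨F, fun a b ha hab hb hp => hF a b (hs.trans ha) hab (hb.trans ht) hp⟩

theorem and (hP : PiecewiseOn P s t) (hQ : PiecewiseOn Q s t) :
    PiecewiseOn (fun a b => P a b ∧ Q a b) s t := by
  obtain ⟨F, hF⟩ := hP
  obtain ⟨G, hG⟩ := hQ
  refine ⟨F ∪ G, fun a b ha hab hb hp => ⟨hF a b ha hab hb fun p h => ?_,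
    hG a b ha hab hb fun p h => ?_⟩⟩
  · exact hp p (Finset.mem_union_left _ h)
  · exact hp p (Finset.mem_union_right _ h)

theorem forall_of_finite {ι : Type*} [Fintype ι] {P : ι → ℝ → ℝ → Prop}
    (h : ∀ i, PiecewiseOn (P i) s t) : PiecewiseOn (fun a b => ∀ i, P i a b) s t := by
  choose F hF using h
  refine ⟨Finset.univ.biUnion F, fun a b ha hab hb hp i => hF i a b ha hab hb fun p h => ?_⟩
  exact hp p (Finset.mem_biUnion.2 ⟨i, Finset.mem_univ _, h⟩)

theorem glue (h₁ : PiecewiseOn P s m) (h₂ : PiecewiseOn P m t) : PiecewiseOn P s t := by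
  obtain ⟨F, hF⟩ := h₁
  obtain ⟨G, hG⟩ := h₂
  refine ⟨insert m (F ∪ G), fun a b ha hab hb hp => ?_⟩
  have hm := hp m (Finset.mem_insert_self _ _)
  rcases le_or_gt b m with hbm | hbm
  · exact hF a b ha hab hbm fun p h =>
      hp p (Finset.mem_insert_of_mem (Finset.mem_union_left _ h))
  · have ham : m ≤ a := not_lt.1 fun h => hm ⟨h, hbm⟩
    exact hG a b ham hab hb fun p h =>
      hp p (Finset.mem_insert_of_mem (Finset.mem_union_right _ h))

/-- A property of intervals that can be glued holds on `[s, t]` if it follows from a property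
that holds piecewise on `[s, t]`. -/
theorem induction (h : PiecewiseOn P s t) (hst : s < t)
    (base : ∀ a b, s ≤ a → a < b → b ≤ t → P a b → Q a b)
    (glue : ∀ a m b, s ≤ a → a < m → m < b → b ≤ t → Q a m → Q m b → Q a b) : Q s t := by
  obtain ⟨F, hF⟩ := h
  suffices H : ∀ G : Finset ℝ, ∀ a b, s ≤ a → a < b → b ≤ t →
      (∀ p ∈ F, a < p → p < b → p ∈ G) → Q a b from
    H F s t le_rfl hst le_rfl fun p hp _ _ => hp
  intro G
  induction G using Finset.induction_on with
  | empty =>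
    intro a b ha hab hb hp
    exact base a b ha hab hb
      (hF a b ha hab hb fun p h hh => Finset.notMem_empty _ (hp p h hh.1 hh.2))
  | insert c G _ ih =>
    intro a b ha hab hb hp
    by_cases hc : a < c ∧ c < b
    · refine glue a c b ha hc.1 hc.2 hb (ih a c ha hc.1 (hc.2.le.trans hb) ?_)
        (ih c b (ha.trans hc.1.le) hc.2 hb ?_)
      · intro p h h1 h2
        exact (Finset.mem_insert.1 (hp p h h1 (h2.trans hc.2))).resolve_left h2.ne
      · intro p h h1 h2
        exact (Finset.mem_insert.1 (hp p h (hc.1.trans h1) h2)).resolve_left h1.ne'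
    · refine ih a b ha hab hb fun p h h1 h2 => ?_
      refine (Finset.mem_insert.1 (hp p h h1 h2)).resolve_left ?_
      rintro rfl
      exact hc ⟨h1, h2⟩

end PiecewiseOn

/-- `g` is constant on `[a, b)`. -/
def ConstIco (g : ℝ → ℝ) (a b : ℝ) : Prop := ∀ θ ∈ Ico a b, g θ = g a

/-- `g` is affine on `[a, b]`. -/
def AffineIcc (g : ℝ → ℝ) (a b : ℝ) : Prop := ∃ c, ∀ θ ∈ Icc a b, g θ = g a + c * (θ - a)

/-- On `[a, b)` the rates `x` and `y` are constant and `q` grows with rate `x - y`. -/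
def QueuePhase (x y q : ℝ → ℝ) (a b : ℝ) : Prop :=
  ConstIco x a b ∧ ConstIco y a b ∧ ∀ θ ∈ Icc a b, q θ = q a + (x a - y a) * (θ - a)

/-- The function that equals `f` before `m` and `g` from `m` on. -/
noncomputable def glueAt (m : ℝ) (f g : ℝ → ℝ) (θ : ℝ) : ℝ := if θ < m then f θ else g θ

theorem glueAt_of_lt {m θ : ℝ} {f g : ℝ → ℝ} (h : θ < m) : glueAt m f g θ = f θ := if_pos h

theorem glueAt_of_ge {m θ : ℝ} {f g : ℝ → ℝ} (h : m ≤ θ) : glueAt m f g θ = g θ :=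
  if_neg h.not_gt

theorem glueAt_of_le {m θ : ℝ} {f g : ℝ → ℝ} (hfg : f m = g m) (h : θ ≤ m) :
    glueAt m f g θ = f θ := by
  rcases h.lt_or_eq with h | rfl
  · exact glueAt_of_lt h
  · rw [glueAt_of_ge le_rfl, hfg]

theorem ConstIco.congr {f g : ℝ → ℝ} {a b : ℝ} (hab : a < b) (h : ConstIco f a b)
    (hfg : ∀ θ ∈ Ico a b, g θ = f θ) : ConstIco g a b := fun θ hθ => by
  rw [hfg θ hθ, hfg a ⟨le_rfl, hab⟩, h θ hθ]

theorem AffineIcc.congr {f g : ℝ → ℝ} {a b : ℝ} (hab : a < b) (h : AffineIcc f a b)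
    (hfg : ∀ θ ∈ Icc a b, g θ = f θ) : AffineIcc g a b := by
  obtain ⟨c, hc⟩ := h
  exact ⟨c, fun θ hθ => by rw [hfg θ hθ, hfg a ⟨le_rfl, hab.le⟩, hc θ hθ]⟩

theorem QueuePhase.congr {x y q x' y' q' : ℝ → ℝ} {a b : ℝ} (hab : a < b)
    (h : QueuePhase x y q a b) (hx : ∀ θ ∈ Ico a b, x' θ = x θ)
    (hy : ∀ θ ∈ Ico a b, y' θ = y θ) (hq : ∀ θ ∈ Icc a b, q' θ = q θ) :
    QueuePhase x' y' q' a b := by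
  refine ⟨h.1.congr hab hx, h.2.1.congr hab hy, fun θ hθ => ?_⟩
  rw [hq θ hθ, hq a ⟨le_rfl, hab.le⟩, hx a ⟨le_rfl, hab⟩, hy a ⟨le_rfl, hab⟩, h.2.2 θ hθ]

/-- Phases on both sides of `m` glue to phases of the glued functions. -/
theorem PiecewiseOn.queuePhase_glueAt {s m t : ℝ} {x₁ y₁ q₁ x₂ y₂ q₂ : ℝ → ℝ}
    (h₁ : PiecewiseOn (QueuePhase x₁ y₁ q₁) s m) (h₂ : PiecewiseOn (QueuePhase x₂ y₂ q₂) m t)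
    (hq : q₁ m = q₂ m) :
    PiecewiseOn (QueuePhase (glueAt m x₁ x₂) (glueAt m y₁ y₂) (glueAt m q₁ q₂)) s t := by
  refine PiecewiseOn.glue (m := m) (h₁.mono fun a b _ hab hb h => ?_)
    (h₂.mono fun a b ha hab _ h => ?_)
  · exact h.congr hab (fun θ hθ => glueAt_of_lt (hθ.2.trans_le hb))
      (fun θ hθ => glueAt_of_lt (hθ.2.trans_le hb))
      (fun θ hθ => glueAt_of_le hq (hθ.2.trans hb))
  · exact h.congr hab (fun θ hθ => glueAt_of_ge (ha.trans hθ.1))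
      (fun θ hθ => glueAt_of_ge (ha.trans hθ.1)) (fun θ hθ => glueAt_of_ge (ha.trans hθ.1))

theorem PiecewiseOn.affineIcc_glueAt {s m t : ℝ} {f g : ℝ → ℝ}
    (h₁ : PiecewiseOn (AffineIcc f) s m) (h₂ : PiecewiseOn (AffineIcc g) m t)
    (hfg : f m = g m) : PiecewiseOn (AffineIcc (glueAt m f g)) s t := by
  refine PiecewiseOn.glue (m := m) (h₁.mono fun a b _ hab hb h => ?_)
    (h₂.mono fun a b ha hab _ h => ?_)
  · exact h.congr hab (fun θ hθ => glueAt_of_le hfg (hθ.2.trans hb))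
  · exact h.congr hab (fun θ hθ => glueAt_of_ge (ha.trans hθ.1))

/-! ### Water filling -/

section WaterFilling

variable {I : Type}

/-- `r` is a water level for the total rate `b` on the set `A`: edges with idle slope below `r`
absorb at most `b`, those with idle slope at most `r` can absorb at least `b`. -/
def IsWaterLevel (ν a σ : I → ℝ) (A : Finset I) (b r : ℝ) : Prop :=
  (∃ i ∈ A, σ i ≤ r) ∧
  (∑ i ∈ A with σ i < r, ν i * (r - a i + 1)) ≤ b ∧
  b ≤ ∑ i ∈ A with σ i ≤ r, ν i * (r - a i + 1)

open Filter Topology in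
theorem exists_isWaterLevel [Finite I] {ν a σ : I → ℝ} {A : Finset I} {b : ℝ} (hA : A.Nonempty)
    (hν : ∀ i, 0 < ν i) (hσ : ∀ i, a i - 1 ≤ σ i) (hb : 0 ≤ b) :
    ∃ r, IsWaterLevel ν a σ A b r := by
  set M : Set ℝ := {r | (∑ i ∈ A with σ i < r, ν i * (r - a i + 1)) ≤ b} with hM
  obtain ⟨i₀, hi₀, hmin⟩ := A.exists_min_image σ hA
  have hmem : σ i₀ ∈ M := by
    have : (A.filter fun i => σ i < σ i₀) = ∅ :=
      Finset.filter_eq_empty_iff.2 fun i hi => not_lt.2 (hmin i hi)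
    simp [hM, this, hb]
  have hbdd : BddAbove M := by
    refine ⟨max (σ i₀) (b / ν i₀ + a i₀ - 1), fun r hr => ?_⟩
    rcases le_or_gt r (σ i₀) with h | h
    · exact h.trans (le_max_left _ _)
    · refine le_trans ?_ (le_max_right _ _)
      have h1 : ν i₀ * (r - a i₀ + 1) ≤ b := by
        refine le_trans ?_ hr
        refine Finset.single_le_sum (f := fun i => ν i * (r - a i + 1)) (fun i hi => ?_)
          (Finset.mem_filter.2 ⟨hi₀, h⟩)
        have := (Finset.mem_filter.1 hi).2
        exact mul_nonneg (hν i).le (by linarith [hσ i])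
      have : r - a i₀ + 1 ≤ b / ν i₀ := by
        rw [le_div_iff₀ (hν i₀)]; linarith
      linarith
  have hlub : IsLUB M (sSup M) := isLUB_csSup ⟨_, hmem⟩ hbdd
  set r := sSup M
  have hcont : ∀ B : Finset I, Continuous fun ρ : ℝ => ∑ i ∈ B, ν i * (ρ - a i + 1) :=
    fun B => by fun_prop
  refine ⟨r, ⟨i₀, hi₀, hlub.1 hmem⟩, ?_, ?_⟩
  · by_contra! hlt
    have h1 : ∀ᶠ ρ in 𝓝[≤] r, b < ∑ i ∈ A with σ i < r, ν i * (ρ - a i + 1) :=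
      ((hcont _).continuousAt.eventually (lt_mem_nhds hlt)).filter_mono nhdsWithin_le_nhds
    have h2 : ∀ᶠ ρ in 𝓝[≤] r, ∀ i, σ i < r → σ i < ρ := by
      refine eventually_all.2 fun i => ?_
      by_cases hi : σ i < r
      · filter_upwards [nhdsWithin_le_nhds (lt_mem_nhds hi)] with ρ hρ _ using hρ
      · exact Eventually.of_forall fun ρ h => absurd h hi
    obtain ⟨ρ, hρM, h1, h2, h3⟩ := ((hlub.frequently_mem ⟨_, hmem⟩).and_eventually
      (h1.and (h2.and self_mem_nhdsWithin))).exists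
    have : (A.filter fun i => σ i < r) = A.filter fun i => σ i < ρ :=
      Finset.filter_congr fun i _ => ⟨h2 i, fun h => h.trans_le h3⟩
    rw [this] at h1
    exact absurd hρM (not_le.2 h1)
  · by_contra! hlt
    have h1 : ∀ᶠ ρ in 𝓝[>] r, (∑ i ∈ A with σ i ≤ r, ν i * (ρ - a i + 1)) < b :=
      ((hcont _).continuousAt.eventually (gt_mem_nhds hlt)).filter_mono nhdsWithin_le_nhds
    have h2 : ∀ᶠ ρ in 𝓝[>] r, ∀ i, r < σ i → ρ < σ i := by
      refine eventually_all.2 fun i => ?_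
      by_cases hi : r < σ i
      · filter_upwards [nhdsWithin_le_nhds (gt_mem_nhds hi)] with ρ hρ _ using hρ
      · exact Eventually.of_forall fun ρ h => absurd h hi
    obtain ⟨ρ, h1, h2, h3⟩ := (h1.and (h2.and self_mem_nhdsWithin)).exists
    have : (A.filter fun i => σ i ≤ r) = A.filter fun i => σ i < ρ :=
      Finset.filter_congr fun i _ => ⟨fun h => h.trans_lt h3, fun h => not_lt.1 fun h' =>
        lt_asymm h (h2 i h')⟩
    rw [this] at h1
    exact absurd (hlub.1 (show ρ ∈ M from h1.le)) (not_le.2 h3)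

/-- Positive affine functions stay positive up to the first time one of them vanishes. -/
theorem exists_first_zero (J : Finset I) (c d : I → ℝ) (hc : ∀ j ∈ J, 0 < c j) {T : ℝ}
    (hT : 0 < T) :
    ∃ h, 0 < h ∧ h ≤ T ∧ (∀ j ∈ J, ∀ r, 0 ≤ r → r < h → 0 < c j + d j * r) ∧
      (∀ j ∈ J, 0 ≤ c j + d j * h) ∧ (h = T ∨ ∃ j ∈ J, c j + d j * h = 0) := by
  classical
  induction J using Finset.induction_on with
  | empty => exact ⟨T, hT, le_rfl, by simp, by simp, Or.inl rfl⟩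
  | insert k J _ ih =>
    obtain ⟨h, h0, hle, hpos, hnn, hev⟩ := ih fun j hj => hc j (Finset.mem_insert_of_mem hj)
    have hck := hc k (Finset.mem_insert_self _ _)
    rcases lt_or_ge 0 (c k + d k * h) with hk | hk
    · refine ⟨h, h0, hle, ?_, ?_, ?_⟩
      · intro j hj r hr hrh
        rcases Finset.mem_insert.1 hj with rfl | hj
        · rcases le_total 0 (d j) with hd | hd
          · have := mul_nonneg hd hr; linarith
          · nlinarith
        · exact hpos j hj r hr hrh
      · intro j hj
        rcases Finset.mem_insert.1 hj with rfl | hj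
        · exact hk.le
        · exact hnn j hj
      · exact hev.imp_right fun ⟨j, hj, h⟩ => ⟨j, Finset.mem_insert_of_mem hj, h⟩
    · have hd : d k < 0 := by
        by_contra! hd
        have := mul_nonneg hd h0.le
        linarith
      have heq : c k + d k * (c k / -d k) = 0 := by
        have := hd.ne
        field_simp
        ring
      have hh : c k / -d k ≤ h := by
        rw [div_le_iff₀ (by linarith)]; linarith
      have hh0 : 0 < c k / -d k := div_pos hck (by linarith)
      refine ⟨c k / -d k, hh0, hh.trans hle, ?_, ?_, Or.inr ⟨k, Finset.mem_insert_self _ _, heq⟩⟩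
      · intro j hj r hr hrh
        rcases Finset.mem_insert.1 hj with rfl | hj
        · nlinarith
        · exact hpos j hj r hr (hrh.trans_le hh)
      · intro j hj
        rcases Finset.mem_insert.1 hj with rfl | hj
        · exact heq.ge
        · rcases hh.lt_or_eq with hlt | heq'
          · exact (hpos j hj _ hh0.le hlt).le
          · rw [heq']; exact hnn j hj

end WaterFilling

/-! ### One phase at a single node -/

section Node

variable {I : Type}

/-- The slope of the cost of an unused edge with relative queue length `z`. -/
noncomputable def idleSlope (a z : I → ℝ) (i : I) : ℝ := if 0 < z i then a i - 1 else a i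

theorem idleSlope_ge (a z : I → ℝ) (i : I) : a i - 1 ≤ idleSlope a z i := by
  unfold idleSlope; split_ifs <;> linarith

theorem idleSlope_le (a z : I → ℝ) (i : I) : idleSlope a z i ≤ a i := by
  unfold idleSlope; split_ifs <;> linarith

/-- The slope of the relative queue length `z` in a phase with label slope `r`. -/
noncomputable def queueSlope (a c z : I → ℝ) (l r : ℝ) (i : I) : ℝ :=
  open Classical in
  if c i + z i = l ∧ idleSlope a z i ≤ r then r - a i else idleSlope a z i - a i

theorem queueSlope_of_mem {a c z : I → ℝ} {l r : ℝ} {i : I} (h : c i + z i = l)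
    (h' : idleSlope a z i ≤ r) : queueSlope a c z l r i = r - a i := if_pos ⟨h, h'⟩

theorem queueSlope_of_not_mem {a c z : I → ℝ} {l r : ℝ} {i : I}
    (h : ¬ (c i + z i = l ∧ idleSlope a z i ≤ r)) :
    queueSlope a c z l r i = idleSlope a z i - a i := if_neg h

/-- The stage of an edge: `2` if the label rises faster than the cost of the edge without queue,
else `1` as long as there is a queue, and `0` without queue. -/
noncomputable def edgeStage (a z : I → ℝ) (r : ℝ) (i : I) : ℕ :=
  if a i < r then 2 else if 0 < z i then 1 else 0

/-- Counts the ways in which an inactive edge approaching the label can cause the end of a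
phase. -/
noncomputable def pendingStage (a c z : I → ℝ) (l r : ℝ) (i : I) : ℕ :=
  open Classical in
  if c i + z i ≠ l ∧ idleSlope a z i < r then (if 0 < z i then 2 else 1) else 0

theorem pendingStage_of_pending {a c z : I → ℝ} {l r : ℝ} {i : I} (h : c i + z i ≠ l)
    (h' : idleSlope a z i < r) : pendingStage a c z l r i = if 0 < z i then 2 else 1 :=
  if_pos ⟨h, h'⟩

theorem pendingStage_of_not_pending {a c z : I → ℝ} {l r : ℝ} {i : I}
    (h : ¬ (c i + z i ≠ l ∧ idleSlope a z i < r)) : pendingStage a c z l r i = 0 := if_neg h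

variable [Fintype I]

/-- The edges whose cost `c + z` equals the label `l`. -/
noncomputable def activeSet (c z : I → ℝ) (l : ℝ) : Finset I :=
  open Classical in Finset.univ.filter fun i => c i + z i = l

theorem mem_activeSet {c z : I → ℝ} {l : ℝ} {i : I} :
    i ∈ activeSet c z l ↔ c i + z i = l := by simp [activeSet]

/-- The inflow rates of a phase whose label slope is a water level. -/
theorem IsWaterLevel.exists_rates {ν a c z : I → ℝ} {l b r : ℝ} (hν : ∀ i, 0 < ν i)
    (h : IsWaterLevel ν a (idleSlope a z) (activeSet c z l) b r) :
    ∃ x : I → ℝ, (∀ i, 0 ≤ x i) ∧ ∑ i, x i = b ∧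
      (∀ i, 0 < x i → c i + z i = l ∧ idleSlope a z i ≤ r) ∧
      (∀ i, 0 < z i → x i - ν i * queueSlope a c z l r i = ν i) ∧
      (∀ i, z i = 0 → 0 < queueSlope a c z l r i →
        ν i ≤ x i ∧ x i - ν i * queueSlope a c z l r i = ν i) ∧
      (∀ i, z i = 0 → 0 ≤ queueSlope a c z l r i) ∧
      (∀ i, z i = 0 → queueSlope a c z l r i = 0 → x i ≤ ν i) := by
  classical
  obtain ⟨-, hlo, hhi⟩ := h
  set σ := idleSlope a z with hσ
  set A := activeSet c z l with hA
  set f : I → ℝ := fun i => ν i * (r - a i + 1) with hf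
  obtain ⟨ρ, hρ0, hρ1, hρ⟩ : ∃ ρ : ℝ, 0 ≤ ρ ∧ ρ ≤ 1 ∧
      (∑ i ∈ A with σ i < r, f i) + ρ * (∑ i ∈ A with σ i = r, f i) = b := by
    have hsplit : ∑ i ∈ A with σ i ≤ r, f i
        = (∑ i ∈ A with σ i < r, f i) + ∑ i ∈ A with σ i = r, f i := by
      simp only [Finset.sum_filter, ← Finset.sum_add_distrib]
      refine Finset.sum_congr rfl fun i _ => ?_
      rcases lt_trichotomy (σ i) r with h | h | h
      · simp [h, h.le, h.ne]
      · simp [h]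
      · simp [h.not_gt, h.not_ge, h.ne']
    change b ≤ ∑ i ∈ A with σ i ≤ r, f i at hhi
    change (∑ i ∈ A with σ i < r, f i) ≤ b at hlo
    rw [hsplit] at hhi
    rcases eq_or_lt_of_le (show 0 ≤ ∑ i ∈ A with σ i = r, f i by linarith) with h0 | h0
    · exact ⟨0, le_rfl, zero_le_one, by linarith⟩
    · refine ⟨(b - ∑ i ∈ A with σ i < r, f i) / ∑ i ∈ A with σ i = r, f i,
        div_nonneg (by linarith) h0.le, ?_, ?_⟩
      · rw [div_le_one h0]; linarith
      · rw [div_mul_cancel₀ _ h0.ne']; ring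
  let x : I → ℝ := fun i =>
    if i ∈ A then (if σ i < r then f i else if σ i = r then ρ * f i else 0) else 0
  have hfnn : ∀ i, σ i ≤ r → 0 ≤ f i := fun i hi =>
    mul_nonneg (hν i).le (by linarith [idleSlope_ge a z i])
  have hxS : ∀ i, ¬ (c i + z i = l ∧ σ i ≤ r) → x i = 0 := by
    intro i hi
    by_cases hiA : i ∈ A
    · have : ¬ σ i ≤ r := fun h => hi ⟨mem_activeSet.1 hiA, h⟩
      have h1 : ¬ σ i < r := fun h => this h.le
      have h2 : ¬ σ i = r := fun h => this h.le
      simp [x, h1, h2]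
    · simp [x, hiA]
  have hσpos : ∀ i, 0 < z i → σ i = a i - 1 := fun i hi => if_pos hi
  have hσzero : ∀ i, z i = 0 → σ i = a i := fun i hi => if_neg (by simp [hi])
  have hxlt : ∀ i, c i + z i = l → σ i < r → x i = f i := fun i h1 h2 => by
    have : i ∈ A := mem_activeSet.2 h1
    simp [x, this, h2]
  have hxeq : ∀ i, c i + z i = l → σ i = r → x i = ρ * f i := fun i h1 h2 => by
    have : i ∈ A := mem_activeSet.2 h1
    simp [x, this, h2]
  refine ⟨x, fun i => ?_, ?_, fun i hi => ?_, fun i hi => ?_, fun i hi hs => ?_,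
    fun i hi => ?_, fun i hi hs => ?_⟩
  · by_cases h : c i + z i = l ∧ σ i ≤ r
    · rcases h.2.lt_or_eq with h' | h'
      · rw [hxlt i h.1 h']; exact hfnn i h.2
      · rw [hxeq i h.1 h']; exact mul_nonneg hρ0 (hfnn i h.2)
    · rw [hxS i h]
  · rw [← hρ, Finset.mul_sum]
    simp only [Finset.sum_filter, ← Finset.sum_add_distrib]
    rw [← Finset.sum_filter_add_sum_filter_not Finset.univ (· ∈ A) x]
    have : ∑ i with i ∉ A, x i = 0 :=
      Finset.sum_eq_zero fun i hi => by simp [x, (Finset.mem_filter.1 hi).2]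
    rw [this, add_zero]
    refine Finset.sum_congr (by ext; simp) fun i hi => ?_
    rcases lt_trichotomy (σ i) r with h | h | h
    · simp [x, hi, h, h.ne]
    · simp [x, hi, h]
    · simp [x, h.not_gt, h.ne']
  · by_contra h
    exact hi.ne' (hxS i h)
  · by_cases h : c i + z i = l ∧ σ i ≤ r
    · rw [queueSlope_of_mem h.1 h.2]
      rcases h.2.lt_or_eq with h' | h'
      · rw [hxlt i h.1 h']; simp only [hf]; ring
      · rw [hxeq i h.1 h', show r = a i - 1 by rw [← h', hσpos i hi]]; simp only [hf]
        rw [show r = a i - 1 by rw [← h', hσpos i hi]]; ring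
    · rw [queueSlope_of_not_mem h, hxS i h]
      change 0 - ν i * (σ i - a i) = ν i
      rw [hσpos i hi]; ring
  · by_cases h : c i + z i = l ∧ σ i ≤ r
    · rw [queueSlope_of_mem h.1 h.2] at hs ⊢
      have h' : σ i < r := by rw [hσzero i hi]; linarith
      rw [hxlt i h.1 h']
      simp only [hf]
      constructor <;> nlinarith [hν i]
    · rw [queueSlope_of_not_mem h] at hs
      have := hσzero i hi
      rw [hσ] at this
      linarith
  · by_cases h : c i + z i = l ∧ σ i ≤ r
    · rw [queueSlope_of_mem h.1 h.2]; linarith [hσzero i hi, h.2]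
    · rw [queueSlope_of_not_mem h]
      have := hσzero i hi
      rw [hσ] at this
      linarith
  · by_cases h : c i + z i = l ∧ σ i ≤ r
    · rw [queueSlope_of_mem h.1 h.2] at hs
      have h' : σ i = r := by rw [hσzero i hi]; linarith
      rw [hxeq i h.1 h']
      simp only [hf]
      rw [hs]
      nlinarith [hν i]
    · rw [hxS i h]; exact (hν i).le

/-! ### The number of phases -/

/-- The rank of an edge by the slope of its cost. -/
noncomputable def slopeRank (a : I → ℝ) (i : I) : ℕ :=
  open Classical in (Finset.univ.filter fun j => a j < a i).card

/-- A weight of edges that dominates twice the sum of all weights of edges of smaller slope. -/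
noncomputable def slopeWeight (a : I → ℝ) (i : I) : ℕ :=
  (2 * Fintype.card I + 1) ^ slopeRank a i

theorem slopeRank_lt {a : I → ℝ} {i j : I} (h : a j < a i) : slopeRank a j < slopeRank a i := by
  classical
  refine Finset.card_lt_card ⟨fun k hk => ?_, fun hs => ?_⟩
  · simp only [Finset.mem_filter, Finset.mem_univ, true_and] at hk ⊢
    exact hk.trans h
  · have := hs (Finset.mem_filter.2 ⟨Finset.mem_univ j, h⟩)
    simp at this

open Classical in
theorem sum_slopeWeight_lt (a : I → ℝ) (i : I) :
    ∑ j with a j < a i, 2 * slopeWeight a j < slopeWeight a i := by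
  have hle : ∑ j with a j < a i, 2 * slopeWeight a j
      ≤ ∑ _j : I with a _j < a i, 2 * (2 * Fintype.card I + 1) ^ (slopeRank a i - 1) := by
    refine Finset.sum_le_sum fun j hj => Nat.mul_le_mul_left _ ?_
    refine Nat.pow_le_pow_right (by lia) ?_
    have := slopeRank_lt (Finset.mem_filter.1 hj).2
    lia
  refine hle.trans_lt ?_
  rw [Finset.sum_const, smul_eq_mul]
  change slopeRank a i * _ < (2 * Fintype.card I + 1) ^ slopeRank a i
  rcases Nat.eq_zero_or_pos (slopeRank a i) with h0 | h0
  · simp [h0]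
  · have hcard : slopeRank a i ≤ Fintype.card I := Finset.card_le_univ _
    obtain ⟨k, hk⟩ : ∃ k, slopeRank a i = k + 1 := ⟨_, (Nat.succ_pred_eq_of_pos h0).symm⟩
    have hp : 0 < (2 * Fintype.card I + 1) ^ k := by positivity
    rw [hk] at hcard ⊢
    rw [Nat.add_sub_cancel, pow_succ]
    nlinarith

/-- The measure that decreases from phase to phase. -/
noncomputable def phaseMeasure (a c z : I → ℝ) (l r : ℝ) : ℕ ×ₗ ℕ :=
  toLex (∑ i, slopeWeight a i * edgeStage a z r i, ∑ i, pendingStage a c z l r i)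

theorem sum_edgeStage_lt {a z z' : I → ℝ} {r r' : ℝ} (e : I)
    (he : edgeStage a z' r' e < edgeStage a z r e)
    (hle : ∀ i, a e ≤ a i → edgeStage a z' r' i ≤ edgeStage a z r i) :
    ∑ i, slopeWeight a i * edgeStage a z' r' i < ∑ i, slopeWeight a i * edgeStage a z r i := by
  classical
  have hkey : ∀ i, slopeWeight a i * edgeStage a z' r' i + (if i = e then slopeWeight a i else 0)
      ≤ slopeWeight a i * edgeStage a z r i + if a i < a e then 2 * slopeWeight a i else 0 := by
    intro i
    by_cases hie : i = e
    · subst hie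
      have : slopeWeight a i * (edgeStage a z' r' i + 1) ≤ slopeWeight a i * edgeStage a z r i :=
        Nat.mul_le_mul_left _ he
      simp only [if_true, lt_irrefl, if_false]
      linarith
    · rw [if_neg hie]
      by_cases hlt : a i < a e
      · have h2 : edgeStage a z' r' i ≤ 2 := by unfold edgeStage; split_ifs <;> simp
        have := Nat.mul_le_mul_left (slopeWeight a i) h2
        rw [if_pos hlt]
        lia
      · rw [if_neg hlt]
        exact Nat.add_le_add_right (Nat.mul_le_mul_left _ (hle i (not_lt.1 hlt))) _
  have hsum := Finset.sum_le_sum fun i (_ : i ∈ Finset.univ) => hkey i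
  rw [Finset.sum_add_distrib, Finset.sum_add_distrib, Finset.sum_ite_eq' Finset.univ e,
    if_pos (Finset.mem_univ e), ← Finset.sum_filter] at hsum
  have := sum_slopeWeight_lt a e
  lia

/-- After a phase of length `h` that ends with an event, the measure has decreased. -/
theorem phaseMeasure_lt {ν a c z : I → ℝ} {l b r r' h : ℝ} (hν : ∀ i, 0 < ν i)
    (hz : ∀ i, 0 ≤ z i) (h0 : 0 < h)
    (hr : IsWaterLevel ν a (idleSlope a z) (activeSet c z l) b r)
    {c' z' : I → ℝ} {l' : ℝ} (hc' : ∀ i, c' i = c i + a i * h)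
    (hz' : ∀ i, z' i = z i + queueSlope a c z l r i * h) (hl' : l' = l + r * h)
    (hznn : ∀ i, 0 ≤ z' i)
    (hr' : IsWaterLevel ν a (idleSlope a z') (activeSet c' z' l') b r')
    (hev : (∃ j, 0 < z j ∧ z' j = 0) ∨
      ∃ j, c j + z j ≠ l ∧ idleSlope a z j < r ∧ c' j + z' j = l') :
    phaseMeasure a c' z' l' r' < phaseMeasure a c z l r := by
  classical
  have hact : ∀ i, c i + z i = l → idleSlope a z i ≤ r → c' i + z' i = l' := by
    intro i h1 h2
    rw [hc', hz', hl', queueSlope_of_mem h1 h2, ← h1]; ring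
  have hempty : ∀ i, z i = 0 → r ≤ a i → z' i = 0 := by
    intro i h1 h2
    have hid : idleSlope a z i = a i := if_neg (by simp [h1])
    rw [hz', h1]
    by_cases hS : c i + z i = l ∧ idleSlope a z i ≤ r
    · rw [queueSlope_of_mem hS.1 hS.2, show r = a i by linarith [hS.2]]; ring
    · rw [queueSlope_of_not_mem hS, hid]; ring
  have hfill : ∀ i, z i = 0 → 0 < z' i → c i + z i = l ∧ idleSlope a z i ≤ r := by
    intro i h1 h2
    by_contra hS
    rw [hz', h1, queueSlope_of_not_mem hS, show idleSlope a z i = a i from if_neg (by simp [h1])]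
      at h2
    simp at h2
  have hpos : ∀ i, z i ≠ 0 → 0 < z i := fun i hi => lt_of_le_of_ne (hz i) (Ne.symm hi)
  have hstage : ∀ i, (r' ≤ a i ∨ r' ≤ r) → edgeStage a z' r' i ≤ edgeStage a z r i := by
    intro i hi
    by_cases h1 : a i < r
    · have : edgeStage a z r i = 2 := if_pos h1
      rw [this]; unfold edgeStage; split_ifs <;> simp
    · have h2 : ¬ a i < r' := by rcases hi with hi | hi <;> linarith
      unfold edgeStage
      rw [if_neg h1, if_neg h2]
      by_cases h3 : z i = 0
      · rw [hempty i h3 (not_lt.1 h1)]; simp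
      · rw [if_pos (hpos i h3)]; split_ifs <;> simp
  rcases lt_or_ge r r' with hlt | hle
  · -- some active edge ran out of queue
    obtain ⟨i₀, hi₀A, hi₀⟩ := hr.1
    obtain ⟨e, heA, her, her'⟩ : ∃ i, c i + z i = l ∧ idleSlope a z i ≤ r ∧
        r' ≤ idleSlope a z' i := by
      by_contra! hno
      have hsub : ((activeSet c z l).filter fun i => idleSlope a z i ≤ r) ⊆
          (activeSet c' z' l').filter fun i => idleSlope a z' i < r' := by
        intro i hi
        obtain ⟨h1, h2⟩ := Finset.mem_filter.1 hi
        exact Finset.mem_filter.2 ⟨mem_activeSet.2 (hact i (mem_activeSet.1 h1) h2),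
          hno i (mem_activeSet.1 h1) h2⟩
      have h1 : ∑ i ∈ activeSet c z l with idleSlope a z i ≤ r, ν i * (r - a i + 1)
          < ∑ i ∈ activeSet c z l with idleSlope a z i ≤ r, ν i * (r' - a i + 1) := by
        refine Finset.sum_lt_sum_of_nonempty ⟨i₀, Finset.mem_filter.2 ⟨hi₀A, hi₀⟩⟩ fun i _ => ?_
        exact mul_lt_mul_of_pos_left (by linarith) (hν i)
      have h2 := Finset.sum_le_sum_of_subset_of_nonneg (f := fun i => ν i * (r' - a i + 1)) hsub
        fun i hi _ => mul_nonneg (hν i).le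
          (by linarith [(Finset.mem_filter.1 hi).2, idleSlope_ge a z' i])
      linarith [hr.2.2, hr'.2.1]
    have hze : 0 < z e ∧ z' e = 0 := by
      by_cases h1 : 0 < z e
      · refine ⟨h1, ?_⟩
        by_contra h2
        have h3 : 0 < z' e := lt_of_le_of_ne (hznn e) (Ne.symm h2)
        rw [idleSlope, if_pos h1] at her
        rw [idleSlope, if_pos h3] at her'
        linarith
      · rw [idleSlope, if_neg h1] at her
        have := idleSlope_le a z' e
        linarith
    have hae : r' ≤ a e := by
      rwa [idleSlope, if_neg (by simp [hze.2])] at her'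
    refine Prod.Lex.toLex_lt_toLex.2 (Or.inl (sum_edgeStage_lt e ?_ fun i hi =>
      hstage i (Or.inl (hae.trans hi))))
    simp [edgeStage, hze.1, hze.2, not_lt.2 hae, not_lt.2 (hlt.le.trans hae)]
  · have hsum : ∑ i, slopeWeight a i * edgeStage a z' r' i
        ≤ ∑ i, slopeWeight a i * edgeStage a z r i :=
      Finset.sum_le_sum fun i _ => Nat.mul_le_mul_left _ (hstage i (Or.inr hle))
    have hidle : ∀ i, (z i = 0 → z' i = 0) → idleSlope a z i ≤ idleSlope a z' i := by
      intro i hi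
      unfold idleSlope
      by_cases h1 : 0 < z i
      · rw [if_pos h1]; split_ifs <;> linarith
      · rw [if_neg h1, if_neg (by simp [hi (le_antisymm (not_lt.1 h1) (hz i))])]
    have hpend : ∀ i, pendingStage a c' z' l' r' i ≤ pendingStage a c z l r i := by
      intro i
      by_cases hp : c' i + z' i ≠ l' ∧ idleSlope a z' i < r'
      · have hzz : z i = 0 → z' i = 0 := by
          intro h1
          by_contra h2
          have h3 := hfill i h1 (lt_of_le_of_ne (hznn i) fun h => h2 h.symm)
          exact hp.1 (hact i h3.1 h3.2)
        have hlt : idleSlope a z i < r := (hidle i hzz).trans_lt (hp.2.trans_le hle)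
        have hna : c i + z i ≠ l := fun h => hp.1 (hact i h hlt.le)
        rw [pendingStage_of_pending hp.1 hp.2, pendingStage_of_pending hna hlt]
        by_cases h1 : z i = 0
        · simp [h1, hzz h1]
        · rw [if_pos (hpos i h1)]; split_ifs <;> simp
      · rw [pendingStage_of_not_pending hp]; exact Nat.zero_le _
    have hfin : ∀ j, pendingStage a c' z' l' r' j < pendingStage a c z l r j →
        phaseMeasure a c' z' l' r' < phaseMeasure a c z l r := by
      intro j hj
      have h2 : ∑ i, pendingStage a c' z' l' r' i < ∑ i, pendingStage a c z l r i :=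
        Finset.sum_lt_sum (fun i _ => hpend i) ⟨j, Finset.mem_univ j, hj⟩
      rcases hsum.lt_or_eq with h | h
      · exact Prod.Lex.toLex_lt_toLex.2 (Or.inl h)
      · exact Prod.Lex.toLex_lt_toLex.2 (Or.inr ⟨h, h2⟩)
    rcases hev with ⟨j, hj, hj'⟩ | ⟨j, hj1, hj2, hj3⟩
    · rcases le_or_gt r (a j) with h1 | h1
      · refine Prod.Lex.toLex_lt_toLex.2 (Or.inl (sum_edgeStage_lt j ?_ fun i _ =>
          hstage i (Or.inr hle)))
        simp [edgeStage, hj, hj', not_lt.2 h1, not_lt.2 (hle.trans h1)]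
      · have hid : idleSlope a z j = a j - 1 := if_pos hj
        have hna : c j + z j ≠ l := by
          intro h
          have h2 := hz' j
          rw [queueSlope_of_mem h (by linarith), hj'] at h2
          nlinarith
        refine hfin j ?_
        rw [pendingStage_of_pending hna (by linarith), if_pos hj]
        by_cases hp : c' j + z' j ≠ l' ∧ idleSlope a z' j < r'
        · rw [pendingStage_of_pending hp.1 hp.2, if_neg (by simp [hj'])]; simp
        · rw [pendingStage_of_not_pending hp]; simp
    · refine hfin j ?_
      rw [pendingStage_of_pending hj1 hj2, pendingStage_of_not_pending (by simp [hj3])]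
      split_ifs <;> simp

end Node

/-! ### Flows at a single node -/

section NodeFlow

variable {I : Type} [Fintype I]

/-- A flow on `[s, t]` through a node with inflow rate `B` and outgoing edges of capacity `ν`,
where `κ` is the cost of continuing to the sink through an edge apart from its waiting time:
`x` and `y` are the rates at which the edges are entered and their queues are left, `q` the
queue lengths and `L` is the label of the node. -/
structure IsNodeFlow (ν : I → ℝ) (κ : I → ℝ → ℝ) (B : ℝ → ℝ) (s t : ℝ)
    (x y q : I → ℝ → ℝ) (L : ℝ → ℝ) : Prop where
  queue : ∀ i, PiecewiseOn (QueuePhase (x i) (y i) (q i)) s t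
  label : PiecewiseOn (AffineIcc L) s t
  nonneg : ∀ θ ∈ Ico s t, ∀ i, 0 ≤ x i θ
  sum_eq : ∀ θ ∈ Ico s t, ∑ i, x i θ = B θ
  outflow : ∀ θ ∈ Ico s t, ∀ i, y i θ = if 0 < q i θ then ν i else min (x i θ) (ν i)
  active : ∀ θ ∈ Ico s t, ∀ i, 0 < x i θ → L θ = κ i θ + q i θ / ν i
  queue_nonneg : ∀ θ ∈ Icc s t, ∀ i, 0 ≤ q i θ
  label_le : ∀ θ ∈ Icc s t, ∀ i, L θ ≤ κ i θ + q i θ / ν i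
  label_eq : ∀ θ ∈ Icc s t, ∃ i, L θ = κ i θ + q i θ / ν i

theorem IsNodeFlow.glueAt {ν : I → ℝ} {κ : I → ℝ → ℝ} {B : ℝ → ℝ} {s m t : ℝ}
    {x₁ y₁ q₁ x₂ y₂ q₂ : I → ℝ → ℝ} {L₁ L₂ : ℝ → ℝ} (hsm : s ≤ m) (hmt : m ≤ t)
    (h₁ : IsNodeFlow ν κ B s m x₁ y₁ q₁ L₁) (h₂ : IsNodeFlow ν κ B m t x₂ y₂ q₂ L₂)
    (hq : ∀ i, q₁ i m = q₂ i m) :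
    IsNodeFlow ν κ B s t (fun i => glueAt m (x₁ i) (x₂ i)) (fun i => glueAt m (y₁ i) (y₂ i))
      (fun i => glueAt m (q₁ i) (q₂ i)) (glueAt m L₁ L₂) := by
  have hm₁ : m ∈ Icc s m := ⟨hsm, le_rfl⟩
  have hm₂ : m ∈ Icc m t := ⟨le_rfl, hmt⟩
  have hL : L₁ m = L₂ m := by
    apply le_antisymm
    · obtain ⟨i, hi⟩ := h₂.label_eq m hm₂
      rw [hi, ← hq]; exact h₁.label_le m hm₁ i
    · obtain ⟨i, hi⟩ := h₁.label_eq m hm₁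
      rw [hi, hq]; exact h₂.label_le m hm₂ i
  have hico : ∀ θ ∈ Ico s t, (θ ∈ Ico s m ∧ ∀ f g, _root_.glueAt m f g θ = f θ) ∨
      (θ ∈ Ico m t ∧ ∀ f g, _root_.glueAt m f g θ = g θ) := fun θ hθ => by
    rcases lt_or_ge θ m with h | h
    · exact Or.inl ⟨⟨hθ.1, h⟩, fun f g => glueAt_of_lt h⟩
    · exact Or.inr ⟨⟨h, hθ.2⟩, fun f g => glueAt_of_ge h⟩
  have hicc : ∀ θ ∈ Icc s t, (θ ∈ Icc s m ∧ ∀ f g, _root_.glueAt m f g θ = f θ) ∨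
      (θ ∈ Icc m t ∧ ∀ f g, _root_.glueAt m f g θ = g θ) := fun θ hθ => by
    rcases lt_or_ge θ m with h | h
    · exact Or.inl ⟨⟨hθ.1, h.le⟩, fun f g => glueAt_of_lt h⟩
    · exact Or.inr ⟨⟨h, hθ.2⟩, fun f g => glueAt_of_ge h⟩
  refine ⟨fun i => (h₁.queue i).queuePhase_glueAt (h₂.queue i) (hq i),
    h₁.label.affineIcc_glueAt h₂.label hL, ?_, ?_, ?_, ?_, ?_, ?_, ?_⟩
  · intro θ hθ
    rcases hico θ hθ with ⟨h, e⟩ | ⟨h, e⟩ <;> simp only [e]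
    exacts [h₁.nonneg θ h, h₂.nonneg θ h]
  · intro θ hθ
    rcases hico θ hθ with ⟨h, e⟩ | ⟨h, e⟩ <;> simp only [e]
    exacts [h₁.sum_eq θ h, h₂.sum_eq θ h]
  · intro θ hθ
    rcases hico θ hθ with ⟨h, e⟩ | ⟨h, e⟩ <;> simp only [e]
    exacts [h₁.outflow θ h, h₂.outflow θ h]
  · intro θ hθ
    rcases hico θ hθ with ⟨h, e⟩ | ⟨h, e⟩ <;> simp only [e]
    exacts [h₁.active θ h, h₂.active θ h]
  · intro θ hθ
    rcases hicc θ hθ with ⟨h, e⟩ | ⟨h, e⟩ <;> simp only [e]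
    exacts [h₁.queue_nonneg θ h, h₂.queue_nonneg θ h]
  · intro θ hθ
    rcases hicc θ hθ with ⟨h, e⟩ | ⟨h, e⟩ <;> simp only [e]
    exacts [h₁.label_le θ h, h₂.label_le θ h]
  · intro θ hθ
    rcases hicc θ hθ with ⟨h, e⟩ | ⟨h, e⟩ <;> simp only [e]
    exacts [h₁.label_eq θ h, h₂.label_eq θ h]

/-- A single phase: constant rates from time `s` on until the next event. -/
theorem IsWaterLevel.exists_phase {ν a z : I → ℝ} {κ : I → ℝ → ℝ} {B : ℝ → ℝ}
    {s t l b r : ℝ} (hν : ∀ i, 0 < ν i) (hst : s < t) (hz : ∀ i, 0 ≤ z i)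
    (hl : ∀ i, l ≤ κ i s + z i)
    (hr : IsWaterLevel ν a (idleSlope a z) (activeSet (fun i => κ i s) z l) b r)
    (hκ : ∀ i, ∀ θ ∈ Icc s t, κ i θ = κ i s + a i * (θ - s))
    (hB : ∀ θ ∈ Ico s t, B θ = b) :
    ∃ h x y q L, 0 < h ∧ s + h ≤ t ∧ IsNodeFlow ν κ B s (s + h) x y q L ∧
      (∀ i, q i s = ν i * z i) ∧
      (∀ i, q i (s + h) = ν i * (z i + queueSlope a (fun i => κ i s) z l r i * h)) ∧
      L (s + h) = l + r * h ∧
      (s + h = t ∨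
        (∃ j, 0 < z j ∧ z j + queueSlope a (fun i => κ i s) z l r j * h = 0) ∨
        ∃ j, κ j s + z j ≠ l ∧ idleSlope a z j < r ∧
          κ j (s + h) + (z j + queueSlope a (fun i => κ i s) z l r j * h) = l + r * h) := by
  classical
  obtain ⟨x, hx0, hxsum, hxact, hxpos, hxzero, hζ0, hxle⟩ := hr.exists_rates hν
  set ζ := queueSlope a (fun i => κ i s) z l r with hζ
  obtain ⟨h₁, h₁0, h₁T, h₁pos, h₁nn, h₁ev⟩ := exists_first_zero
    (Finset.univ.filter fun i => 0 < z i) z ζ (fun j hj => (Finset.mem_filter.1 hj).2)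
    (sub_pos.2 hst)
  obtain ⟨h, h0, hT, hpos, hnn, hev⟩ := exists_first_zero
    (Finset.univ.filter fun i => κ i s + z i ≠ l) (fun i => κ i s + z i - l)
    (fun i => idleSlope a z i - r)
    (fun j hj => sub_pos.2 (lt_of_le_of_ne (hl j) (Finset.mem_filter.1 hj).2.symm)) h₁0
  have hzpos : ∀ i, 0 < z i → ∀ ρ, 0 ≤ ρ → ρ < h → 0 < z i + ζ i * ρ := fun i hi ρ h1 h2 =>
    h₁pos i (by simpa using hi) ρ h1 (h2.trans_le hT)
  have hznn : ∀ i ρ, 0 ≤ ρ → ρ ≤ h → 0 ≤ z i + ζ i * ρ := by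
    intro i ρ h1 h2
    rcases (hz i).lt_or_eq with hi | hi
    · rcases (h2.trans hT).lt_or_eq with h3 | h3
      · exact (h₁pos i (by simpa using hi) ρ h1 h3).le
      · rw [h3]; exact h₁nn i (by simpa using hi)
    · rw [← hi, zero_add]; exact mul_nonneg (hζ0 i hi.symm) h1
  have hlab : ∀ i ρ, 0 ≤ ρ → ρ ≤ h → l + r * ρ ≤ κ i s + a i * ρ + (z i + ζ i * ρ) := by
    intro i ρ h1 h2
    by_cases hA : κ i s + z i = l
    · by_cases hS : idleSlope a z i ≤ r
      · rw [hζ, queueSlope_of_mem hA hS]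
        linarith
      · rw [hζ, queueSlope_of_not_mem fun h => hS h.2]
        have := mul_le_mul_of_nonneg_right (not_le.1 hS).le h1
        linarith
    · rw [hζ, queueSlope_of_not_mem fun h => hA h.1]
      have : 0 ≤ (κ i s + z i - l) + (idleSlope a z i - r) * ρ := by
        rcases h2.lt_or_eq with h3 | h3
        · exact (hpos i (by simpa using hA) ρ h1 h3).le
        · rw [h3]; exact hnn i (by simpa using hA)
      linarith
  have hactive : ∀ i, κ i s + z i = l → idleSlope a z i ≤ r → ∀ ρ,
      l + r * ρ = κ i s + a i * ρ + (z i + ζ i * ρ) := by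
    intro i h1 h2 ρ
    rw [hζ, queueSlope_of_mem h1 h2, ← h1]; ring
  have hle : s + h ≤ t := by linarith
  have hdiv : ∀ i w, ν i * w / ν i = w := fun i w => mul_div_cancel_left₀ _ (hν i).ne'
  have hκ' : ∀ i, ∀ θ ∈ Icc s (s + h), κ i θ = κ i s + a i * (θ - s) := fun i θ hθ =>
    hκ i θ ⟨hθ.1, hθ.2.trans hle⟩
  refine ⟨h, fun i _ => x i, fun i _ => x i - ν i * ζ i, fun i θ => ν i * (z i + ζ i * (θ - s)),
    fun θ => l + r * (θ - s), h0, hle, ?_, fun i => by simp, fun i => by simp, by simp, ?_⟩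
  · refine ⟨fun i => ⟨∅, fun α β _ _ _ _ => ⟨fun _ _ => rfl, fun _ _ => rfl, fun θ _ => by ring⟩⟩,
      ⟨∅, fun α β _ _ _ _ => ⟨r, fun θ _ => by ring⟩⟩, fun θ _ => hx0,
      fun θ hθ => ?_, fun θ hθ i => ?_, fun θ hθ i hi => ?_, fun θ hθ i => ?_, fun θ hθ i => ?_,
      fun θ hθ => ?_⟩
    · rw [hxsum, hB θ ⟨hθ.1, hθ.2.trans_le hle⟩]
    · have h1 : 0 ≤ θ - s := by linarith [hθ.1]
      have h2 : θ - s < h := by linarith [hθ.2]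
      rcases (hz i).lt_or_eq with hi | hi
      · rw [if_pos (mul_pos (hν i) (hzpos i hi _ h1 h2)), hxpos i hi]
      · rcases (hζ0 i hi.symm).lt_or_eq with hi' | hi'
        · obtain ⟨h3, h4⟩ := hxzero i hi.symm hi'
          rw [h4, min_eq_right h3, ite_self]
        · rw [← hi, ← hi']
          simp [hxle i hi.symm hi'.symm]
    · obtain ⟨h1, h2⟩ := hxact i hi
      rw [hdiv, hκ' i θ ⟨hθ.1, hθ.2.le⟩]
      exact hactive i h1 h2 _
    · exact mul_nonneg (hν i).le (hznn i _ (by linarith [hθ.1]) (by linarith [hθ.2]))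
    · rw [hdiv, hκ' i θ hθ]
      exact hlab i _ (by linarith [hθ.1]) (by linarith [hθ.2])
    · obtain ⟨i, hi, hi'⟩ := hr.1
      refine ⟨i, ?_⟩
      rw [hdiv, hκ' i θ hθ]
      exact hactive i (mem_activeSet.1 hi) hi' _
  · rcases hev with hev | ⟨j, hj, hj'⟩
    · rcases h₁ev with h₁ev | ⟨j, hj, hj'⟩
      · left; linarith
      · right; left
        exact ⟨j, by simpa using hj, by rw [hev]; exact hj'⟩
    · right; right
      have hne : κ j s + z j ≠ l := by simpa using hj
      refine ⟨j, hne, ?_, ?_⟩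
      · have : 0 < κ j s + z j - l := sub_pos.2 (lt_of_le_of_ne (hl j) hne.symm)
        by_contra! hge
        have := mul_nonneg (sub_nonneg.2 hge) h0.le
        linarith
      · rw [hκ' j _ ⟨by linarith, le_rfl⟩, hζ, queueSlope_of_not_mem fun h => hne h.1]
        linarith

theorem exists_isNodeFlow_of_isWaterLevel {ν a : I → ℝ} {κ : I → ℝ → ℝ} {B : ℝ → ℝ}
    {t b : ℝ} (hν : ∀ i, 0 < ν i) (hb : 0 ≤ b) (μ : ℕ ×ₗ ℕ) :
    ∀ (s : ℝ) (z : I → ℝ) (l r : ℝ), s < t → (∀ i, 0 ≤ z i) → (∀ i, l ≤ κ i s + z i) →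
      IsWaterLevel ν a (idleSlope a z) (activeSet (fun i => κ i s) z l) b r →
      (∀ i, ∀ θ ∈ Icc s t, κ i θ = κ i s + a i * (θ - s)) → (∀ θ ∈ Ico s t, B θ = b) →
      phaseMeasure a (fun i => κ i s) z l r = μ →
      ∃ x y q L, (∀ i, q i s = ν i * z i) ∧ IsNodeFlow ν κ B s t x y q L := by
  induction μ using WellFoundedLT.induction with
  | ind μ ih =>
  intro s z l r hst hz hl hr hκ hB hμ
  obtain ⟨h, x, y, q, L, h0, hle, hflow, hqs, hqe, hL, hev⟩ := hr.exists_phase hν hst hz hl hκ hB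
  rcases hle.eq_or_lt with heq | hlt
  · exact ⟨x, y, q, L, hqs, heq ▸ hflow⟩
  have hend : s + h ∈ Icc s (s + h) := ⟨by linarith, le_rfl⟩
  have hdiv : ∀ i w, ν i * w / ν i = w := fun i w => mul_div_cancel_left₀ _ (hν i).ne'
  set z' : I → ℝ := fun i => z i + queueSlope a (fun i => κ i s) z l r i * h with hz'
  have hz'nn : ∀ i, 0 ≤ z' i := fun i => by
    have := hflow.queue_nonneg _ hend i
    rw [hqe] at this
    exact nonneg_of_mul_nonneg_right this (hν i)
  have hl' : ∀ i, l + r * h ≤ κ i (s + h) + z' i := fun i => by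
    have := hflow.label_le _ hend i
    rwa [hqe, hL, hdiv] at this
  obtain ⟨r', hr'⟩ : ∃ r', IsWaterLevel ν a (idleSlope a z')
      (activeSet (fun i => κ i (s + h)) z' (l + r * h)) b r' := by
    obtain ⟨i, hi⟩ := hflow.label_eq _ hend
    rw [hqe, hL, hdiv] at hi
    exact exists_isWaterLevel ⟨i, mem_activeSet.2 hi.symm⟩ hν (idleSlope_ge a z') hb
  have hκh : ∀ i, κ i (s + h) = κ i s + a i * h := fun i => by
    rw [hκ i _ ⟨by linarith, hle⟩]; ring
  have hmeas := phaseMeasure_lt hν hz h0 hr hκh (fun i => rfl) rfl hz'nn hr'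
    (hev.resolve_left hlt.ne)
  obtain ⟨x', y', q', L', hq', hflow'⟩ := ih _ (hμ ▸ hmeas) (s + h) z' (l + r * h) r' hlt hz'nn
    hl' hr' (fun i θ hθ => by
      rw [hκ i θ ⟨by linarith [hθ.1], hθ.2⟩, hκh]; ring)
    (fun θ hθ => hB θ ⟨by linarith [hθ.1], hθ.2⟩) rfl
  refine ⟨_, _, _, _, fun i => ?_, hflow.glueAt (by linarith) hlt.le hflow' fun i => ?_⟩
  · rw [glueAt_of_lt (by linarith), hqs]
  · rw [hqe, hq']

/-- For piecewise constant inflow and piecewise affine costs, a node admits a flow with finitely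
many phases. -/
theorem exists_isNodeFlow [Nonempty I] {ν : I → ℝ} {κ : I → ℝ → ℝ} {B : ℝ → ℝ}
    {s t : ℝ} (hν : ∀ i, 0 < ν i) (hst : s < t) (hκ : ∀ i, PiecewiseOn (AffineIcc (κ i)) s t)
    (hB : PiecewiseOn (ConstIco B) s t) (hB0 : ∀ θ ∈ Ico s t, 0 ≤ B θ) (q₀ : I → ℝ)
    (hq₀ : ∀ i, 0 ≤ q₀ i) :
    ∃ x y q L, (∀ i, q i s = q₀ i) ∧ IsNodeFlow ν κ B s t x y q L := by
  revert q₀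
  refine ((PiecewiseOn.forall_of_finite hκ).and hB).induction
    (Q := fun s t => ∀ q₀ : I → ℝ, (∀ i, 0 ≤ q₀ i) →
      ∃ x y q L, (∀ i, q i s = q₀ i) ∧ IsNodeFlow ν κ B s t x y q L) hst ?_ ?_
  · rintro c d hc hcd hd ⟨hκ', hB'⟩ q₀ hq₀
    choose a ha using hκ'
    set z : I → ℝ := fun i => q₀ i / ν i with hz
    obtain ⟨i₀, -, hmin⟩ := Finset.univ.exists_min_image (fun i => κ i c + z i)
      Finset.univ_nonempty
    have hb0 := hB0 c ⟨hc, hcd.trans_le hd⟩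
    obtain ⟨r, hr⟩ := exists_isWaterLevel (ν := ν) (a := a)
      (A := activeSet (fun i => κ i c) z (κ i₀ c + z i₀)) ⟨i₀, mem_activeSet.2 rfl⟩ hν
      (idleSlope_ge a z) hb0
    obtain ⟨x, y, q, L, hq, hflow⟩ := exists_isNodeFlow_of_isWaterLevel hν hb0 _ c z _ r hcd
      (fun i => div_nonneg (hq₀ i) (hν i).le) (fun i => hmin i (Finset.mem_univ i)) hr ha hB' rfl
    exact ⟨x, y, q, L, fun i => by rw [hq, hz]; exact mul_div_cancel₀ _ (hν i).ne', hflow⟩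
  · intro c m d _ hcm hmd _ h₁ h₂ q₀ hq₀
    obtain ⟨x₁, y₁, q₁, L₁, hq₁, hf₁⟩ := h₁ q₀ hq₀
    obtain ⟨x₂, y₂, q₂, L₂, hq₂, hf₂⟩ := h₂ (fun i => q₁ i m)
      (hf₁.queue_nonneg m ⟨hcm.le, le_rfl⟩)
    refine ⟨_, _, _, _, fun i => ?_, hf₁.glueAt hcm.le hmd.le hf₂ fun i => (hq₂ i).symm⟩
    rw [glueAt_of_lt hcm, hq₁]

end NodeFlow

namespace IsNodeFlow

variable {I : Type} [Fintype I] {ν : I → ℝ} {κ κ' : I → ℝ → ℝ} {B B' : ℝ → ℝ} {s t : ℝ}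
  {x y q x' y' q' : I → ℝ → ℝ} {L L' : ℝ → ℝ}

theorem congr (h : IsNodeFlow ν κ B s t x y q L)
    (hκ : ∀ i, ∀ θ ∈ Icc s t, κ' i θ = κ i θ) (hB : ∀ θ ∈ Ico s t, B' θ = B θ)
    (hx : ∀ i, ∀ θ ∈ Ico s t, x' i θ = x i θ) (hy : ∀ i, ∀ θ ∈ Ico s t, y' i θ = y i θ)
    (hq : ∀ i, ∀ θ ∈ Icc s t, q' i θ = q i θ) (hL : ∀ θ ∈ Icc s t, L' θ = L θ) :
    IsNodeFlow ν κ' B' s t x' y' q' L' := by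
  have hc : ∀ {θ}, θ ∈ Ico s t → θ ∈ Icc s t := fun h => Ico_subset_Icc_self h
  refine ⟨fun i => (h.queue i).mono fun a b ha hab hb hp => ?_,
    h.label.mono fun a b ha hab hb hp => ?_, fun θ hθ i => ?_, fun θ hθ => ?_, fun θ hθ i => ?_,
    fun θ hθ i hi => ?_, fun θ hθ i => ?_, fun θ hθ i => ?_, fun θ hθ => ?_⟩
  · exact hp.congr hab (fun θ hθ => hx i θ ⟨ha.trans hθ.1, hθ.2.trans_le hb⟩)
      (fun θ hθ => hy i θ ⟨ha.trans hθ.1, hθ.2.trans_le hb⟩)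
      (fun θ hθ => hq i θ ⟨ha.trans hθ.1, hθ.2.trans hb⟩)
  · exact hp.congr hab fun θ hθ => hL θ ⟨ha.trans hθ.1, hθ.2.trans hb⟩
  · rw [hx i θ hθ]; exact h.nonneg θ hθ i
  · rw [hB θ hθ, ← h.sum_eq θ hθ]; exact Finset.sum_congr rfl fun i _ => hx i θ hθ
  · rw [hx i θ hθ, hy i θ hθ, hq i θ (hc hθ)]; exact h.outflow θ hθ i
  · rw [hx i θ hθ] at hi
    rw [hL θ (hc hθ), hκ i θ (hc hθ), hq i θ (hc hθ)]; exact h.active θ hθ i hi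
  · rw [hq i θ hθ]; exact h.queue_nonneg θ hθ i
  · rw [hL θ hθ, hκ i θ hθ, hq i θ hθ]; exact h.label_le θ hθ i
  · obtain ⟨i, hi⟩ := h.label_eq θ hθ
    exact ⟨i, by rw [hL θ hθ, hκ i θ hθ, hq i θ hθ, hi]⟩

theorem mono_interval {s' t' : ℝ} (h : IsNodeFlow ν κ B s t x y q L) (hs : s ≤ s')
    (ht : t' ≤ t) : IsNodeFlow ν κ B s' t' x y q L :=
  ⟨fun i => (h.queue i).mono_interval hs ht, h.label.mono_interval hs ht,
    fun θ hθ => h.nonneg θ (Ico_subset_Ico hs ht hθ),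
    fun θ hθ => h.sum_eq θ (Ico_subset_Ico hs ht hθ),
    fun θ hθ => h.outflow θ (Ico_subset_Ico hs ht hθ),
    fun θ hθ => h.active θ (Ico_subset_Ico hs ht hθ),
    fun θ hθ => h.queue_nonneg θ (Icc_subset_Icc hs ht hθ),
    fun θ hθ => h.label_le θ (Icc_subset_Icc hs ht hθ),
    fun θ hθ => h.label_eq θ (Icc_subset_Icc hs ht hθ)⟩

theorem outflow_nonneg (h : IsNodeFlow ν κ B s t x y q L) (hν : ∀ i, 0 < ν i) {θ : ℝ}
    (hθ : θ ∈ Ico s t) (i : I) : 0 ≤ y i θ := by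
  rw [h.outflow θ hθ i]
  split_ifs
  exacts [(hν i).le, le_min (h.nonneg θ hθ i) (hν i).le]

end IsNodeFlow

/-! ### Acyclic networks -/

namespace Network

/-- The number of nodes that can be reached from `v` by a nonempty walk. -/
noncomputable def rank (N : Network V E) (v : V) : ℕ :=
  {w | ∃ L : List E, L ≠ [] ∧ IsWalk N.tail N.head v w L}.ncard

variable {N : Network V E}

theorem Acyclic.rank_head_lt (h : N.Acyclic) (e : E) :
    N.rank (N.head e) < N.rank (N.tail e) := by
  refine Set.ncard_lt_ncard ⟨?_, fun hs => ?_⟩ (Set.toFinite _)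
  · rintro w ⟨L, -, hL⟩
    exact ⟨e :: L, by simp, rfl, hL⟩
  · obtain ⟨L, hL, hw⟩ := hs ⟨[e], by simp, rfl, rfl⟩
    exact h _ L hL hw

theorem Acyclic.tail_ne_sink (h : N.Acyclic) (e : E) : N.tail e ≠ N.sink := by
  intro he
  obtain ⟨L, hL⟩ := N.reach (N.head e)
  exact h N.sink (e :: L) (by simp) ⟨he, hL⟩

theorem exists_tail_eq {v : V} (hv : v ≠ N.sink) : ∃ e, N.tail e = v := by
  obtain ⟨L, hL⟩ := N.reach v
  cases L with
  | nil => exact absurd hL hv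
  | cons e L => exact ⟨e, hL.1⟩

end Network

/-- Candidates for the rates at which edges are entered and their queues are left, the queue
lengths and the node labels of a flow. -/
structure FlowData (V E : Type) where
  inRate : E → ℝ → ℝ
  outRate : E → ℝ → ℝ
  queue : E → ℝ → ℝ
  label : V → ℝ → ℝ

/-- The function `y` delayed by `τ`. -/
noncomputable def delayed (τ : ℝ) (y : ℝ → ℝ) (θ : ℝ) : ℝ := if τ ≤ θ then y (θ - τ) else 0

theorem PiecewiseOn.constIco_delayed {τ t : ℝ} {y : ℝ → ℝ}
    (h : PiecewiseOn (ConstIco y) 0 t) : PiecewiseOn (ConstIco (delayed τ y)) 0 (t + τ) := by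
  classical
  obtain ⟨F, hF⟩ := h
  refine ⟨insert τ (F.image (· + τ)), fun a b ha hab hb hp θ hθ => ?_⟩
  rcases le_or_gt τ a with h | h
  · rw [delayed, delayed, if_pos h, if_pos (h.trans hθ.1)]
    refine hF (a - τ) (b - τ) (by linarith) (by linarith) (by linarith) (fun p hpF hpab => ?_)
      (θ - τ) ⟨by linarith [hθ.1], by linarith [hθ.2]⟩
    exact hp (p + τ) (Finset.mem_insert_of_mem (Finset.mem_image_of_mem _ hpF))
      ⟨by linarith [hpab.1], by linarith [hpab.2]⟩
  · have hbτ : b ≤ τ := not_lt.1 fun h' => hp τ (Finset.mem_insert_self _ _) ⟨h, h'⟩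
    rw [delayed, delayed, if_neg (not_le.2 (hθ.2.trans_le hbτ)), if_neg (not_le.2 h)]

theorem RightConstantStep.piecewiseOn {g : ℝ → ℝ} (h : RightConstantStep g) (s t : ℝ) :
    PiecewiseOn (ConstIco g) s t := by
  obtain ⟨F, hF⟩ := h
  refine ⟨F, fun a b _ hab _ hp θ hθ => (hF a θ hθ.1 fun p hpF hpa => ?_).symm⟩
  exact hp p hpF ⟨hpa.1, hpa.2.trans_lt hθ.2⟩

namespace Network

/-- The total rate at which flow arrives at a node. -/
noncomputable def inflow (N : Network V E) (y : E → ℝ → ℝ) (v : V) (θ : ℝ) : ℝ :=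
  N.u v θ + ∑ e ∈ N.inEdges v, delayed (N.time e) (y e) θ

theorem inflow_congr (N : Network V E) {y y' : E → ℝ → ℝ} {θ : ℝ}
    (h : ∀ e, N.time e ≤ θ → y e (θ - N.time e) = y' e (θ - N.time e)) (v : V) :
    N.inflow y v θ = N.inflow y' v θ := by
  unfold inflow delayed
  congr 1
  refine Finset.sum_congr rfl fun e _ => ?_
  split_ifs with he
  exacts [h e he, rfl]

theorem inflow_nonneg (N : Network V E) {y : E → ℝ → ℝ} {θ : ℝ}
    (h : ∀ e, N.time e ≤ θ → 0 ≤ y e (θ - N.time e)) (v : V) : 0 ≤ N.inflow y v θ := by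
  refine add_nonneg (N.u_nonneg v θ) (Finset.sum_nonneg fun e _ => ?_)
  unfold delayed
  split_ifs with he
  exacts [h e he, le_rfl]

theorem piecewiseOn_inflow (N : Network V E) {y : E → ℝ → ℝ} {t ε : ℝ}
    (hε : ∀ e, ε ≤ N.time e) (h : ∀ e, PiecewiseOn (ConstIco (y e)) 0 t) (v : V) :
    PiecewiseOn (ConstIco (N.inflow y v)) 0 (t + ε) := by
  refine (((N.u_step v).piecewiseOn 0 (t + ε)).and (PiecewiseOn.forall_of_finite fun e =>
    (h e).constIco_delayed.mono_interval le_rfl (add_le_add_right (hε e) t))).mono ?_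
  rintro a b - - - ⟨hu, hd⟩ θ hθ
  unfold inflow
  rw [hu θ hθ]
  congr 1
  exact Finset.sum_congr rfl fun e _ => hd e θ hθ

/-- The flow data `D` describe an equilibrium flow through node `v` on `[s, t]`. -/
def IsFlowAt (N : Network V E) (B : V → ℝ → ℝ) (D : FlowData V E) (s t : ℝ) (v : V) : Prop :=
  IsNodeFlow (I := {e // N.tail e = v}) (fun e => N.cap e)
    (fun e θ => N.time e + D.label (N.head e) θ) (B v) s t (fun e => D.inRate e)
    (fun e => D.outRate e) (fun e => D.queue e) (D.label v)

/-- The flow data `D` describe an equilibrium flow on `[s, t]` where `B` are the node inflow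
rates. -/
structure IsFlowOn (N : Network V E) (B : V → ℝ → ℝ) (D : FlowData V E) (s t : ℝ) : Prop where
  sink_label : ∀ θ, D.label N.sink θ = 0
  node : ∀ v, v ≠ N.sink → N.IsFlowAt B D s t v

variable {N : Network V E}

/-- For given node inflow rates there is an equilibrium flow, obtained node by node. -/
theorem Acyclic.exists_isFlowOn (hN : N.Acyclic) {B : V → ℝ → ℝ} {s t : ℝ} (hst : s < t)
    (hB : ∀ v, PiecewiseOn (ConstIco (B v)) s t) (hB0 : ∀ v, ∀ θ ∈ Ico s t, 0 ≤ B v θ)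
    (q₀ : E → ℝ) (hq₀ : ∀ e, 0 ≤ q₀ e) :
    ∃ D, (∀ e, D.queue e s = q₀ e) ∧ N.IsFlowOn B D s t := by
  have key : ∀ n, ∃ D : FlowData V E, (∀ e, D.queue e s = q₀ e) ∧
      (∀ θ, D.label N.sink θ = 0) ∧
      ∀ v, v ≠ N.sink → N.rank v < n → N.IsFlowAt B D s t v := by
    intro n
    induction n with
    | zero => exact ⟨⟨fun _ _ => 0, fun _ _ => 0, fun e _ => q₀ e, fun _ _ => 0⟩,
        fun e => rfl, fun θ => rfl, fun v _ h => absurd h (Nat.not_lt_zero _)⟩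
    | succ n ih =>
      obtain ⟨D, hDq, hDs, hD⟩ := ih
      have hnode : ∀ v, ∃ x y q : {e // N.tail e = v} → ℝ → ℝ, ∃ L : ℝ → ℝ,
          v ≠ N.sink → N.rank v = n → (∀ e, q e s = q₀ e) ∧
          IsNodeFlow (I := {e // N.tail e = v}) (fun e => N.cap e)
            (fun e θ => N.time e + D.label (N.head e) θ) (B v) s t x y q L := by
        intro v
        by_cases hv : v ≠ N.sink ∧ N.rank v = n
        · have : Nonempty {e // N.tail e = v} :=
            let ⟨e, he⟩ := exists_tail_eq hv.1
            ⟨⟨e, he⟩⟩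
          obtain ⟨x, y, q, L, hq, hf⟩ := exists_isNodeFlow
            (I := {e // N.tail e = v}) (ν := fun e => N.cap e)
            (κ := fun e θ => N.time e + D.label (N.head e) θ) (fun e => N.cap_pos e) hst
            (fun e => by
              have hlab : PiecewiseOn (AffineIcc (D.label (N.head e))) s t := by
                by_cases he : N.head e = N.sink
                · exact ⟨∅, fun a b _ _ _ _ => ⟨0, fun θ _ => by rw [he, hDs, hDs]; ring⟩⟩
                · refine (hD _ he ?_).label
                  have := hN.rank_head_lt e
                  rw [e.2, hv.2] at this
                  exact this
              refine hlab.mono fun a b _ _ _ ⟨c, hc⟩ => ⟨c, fun θ hθ => ?_⟩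
              beta_reduce
              rw [hc θ hθ]; ring)
            (hB v) (hB0 v) (fun e => q₀ e) (fun e => hq₀ e)
          exact ⟨x, y, q, L, fun _ _ => ⟨hq, hf⟩⟩
        · exact ⟨fun _ _ => 0, fun _ _ => 0, fun _ _ => 0, fun _ => 0,
            fun h1 h2 => absurd ⟨h1, h2⟩ hv⟩
      choose x y q L hnode using hnode
      let D' : FlowData V E :=
        { inRate := fun e => if N.rank (N.tail e) = n then x _ ⟨e, rfl⟩ else D.inRate e
          outRate := fun e => if N.rank (N.tail e) = n then y _ ⟨e, rfl⟩ else D.outRate e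
          queue := fun e => if N.rank (N.tail e) = n then q _ ⟨e, rfl⟩ else D.queue e
          label := fun v => if v ≠ N.sink ∧ N.rank v = n then L v else D.label v }
      have hhead : ∀ e θ, N.rank (N.tail e) ≤ n →
          D'.label (N.head e) θ = D.label (N.head e) θ := by
        intro e θ he
        have := hN.rank_head_lt e
        simp only [D']
        rw [if_neg fun h => by lia]
      refine ⟨D', fun e => ?_, fun θ => ?_, fun v hv hr => ?_⟩
      · simp only [D']
        split_ifs with h
        · exact (hnode _ (hN.tail_ne_sink e) h).1 _
        · exact hDq e
      · simp only [D', ne_eq, not_true_eq_false, false_and, if_false]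
        exact hDs θ
      · rcases (Nat.lt_succ_iff.1 hr).lt_or_eq with h | h
        · refine (hD v hv h).congr ?_ (fun _ _ => rfl) ?_ ?_ ?_ ?_
          · rintro ⟨e, rfl⟩ θ -
            rw [hhead e θ h.le]
          · rintro ⟨e, rfl⟩ θ -
            simp [D', h.ne]
          · rintro ⟨e, rfl⟩ θ -
            simp [D', h.ne]
          · rintro ⟨e, rfl⟩ θ -
            simp [D', h.ne]
          · rintro θ -
            simp [D', h.ne]
        · refine (hnode v hv h).2.congr ?_ (fun _ _ => rfl) ?_ ?_ ?_ ?_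
          · rintro ⟨e, rfl⟩ θ -
            rw [hhead e θ h.le]
          · rintro ⟨e, rfl⟩ θ -
            simp [D', h]
          · rintro ⟨e, rfl⟩ θ -
            simp [D', h]
          · rintro ⟨e, rfl⟩ θ -
            simp [D', h]
          · rintro θ -
            simp [D', h, hv]
  obtain ⟨D, hq, hs, hD⟩ := key (Finset.univ.sup N.rank + 1)
  exact ⟨D, hq, hs, fun v hv => hD v hv (Nat.lt_succ_of_le (Finset.le_sup (Finset.mem_univ v)))⟩

theorem Acyclic.label_eq_of_queue_eq (hN : N.Acyclic) {B B' : V → ℝ → ℝ} {D D' : FlowData V E}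
    {s t s' t' θ : ℝ} (h : N.IsFlowOn B D s t) (h' : N.IsFlowOn B' D' s' t') (hθ : θ ∈ Icc s t)
    (hθ' : θ ∈ Icc s' t') (hq : ∀ e, D.queue e θ = D'.queue e θ) (v : V) :
    D.label v θ = D'.label v θ := by
  induction hn : N.rank v using Nat.strong_induction_on generalizing v with
  | _ n ih =>
  by_cases hv : v = N.sink
  · rw [hv, h.sink_label, h'.sink_label]
  · have hlab : ∀ e : {e // N.tail e = v},
        D.label (N.head e) θ = D'.label (N.head e) θ := fun e => by
      refine ih _ ?_ _ rfl
      have := hN.rank_head_lt e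
      rwa [e.2, hn] at this
    apply le_antisymm
    · obtain ⟨e, he⟩ := (h'.node v hv).label_eq θ hθ'
      rw [he, ← hlab, ← hq]; exact (h.node v hv).label_le θ hθ e
    · obtain ⟨e, he⟩ := (h.node v hv).label_eq θ hθ
      rw [he, hlab, hq]; exact (h'.node v hv).label_le θ hθ' e

/-- Flow data that agree with `D₁` before `m` and with `D₂` from `m` on. -/
noncomputable def _root_.FlowData.glueAt (m : ℝ) (D₁ D₂ : FlowData V E) : FlowData V E where
  inRate e := _root_.glueAt m (D₁.inRate e) (D₂.inRate e)
  outRate e := _root_.glueAt m (D₁.outRate e) (D₂.outRate e)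
  queue e := _root_.glueAt m (D₁.queue e) (D₂.queue e)
  label v := _root_.glueAt m (D₁.label v) (D₂.label v)

theorem Acyclic.isFlowOn_glueAt (hN : N.Acyclic) {B : V → ℝ → ℝ} {D₁ D₂ : FlowData V E}
    {s m t : ℝ} (hsm : s ≤ m) (hmt : m ≤ t) (h₁ : N.IsFlowOn B D₁ s m)
    (h₂ : N.IsFlowOn B D₂ m t) (hq : ∀ e, D₁.queue e m = D₂.queue e m) :
    N.IsFlowOn B (D₁.glueAt m D₂) s t := by
  have hL := hN.label_eq_of_queue_eq h₁ h₂ ⟨hsm, le_rfl⟩ ⟨le_rfl, hmt⟩ hq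
  refine ⟨fun θ => ?_, fun v hv => ?_⟩
  · simp only [FlowData.glueAt, glueAt]
    split_ifs
    exacts [h₁.sink_label θ, h₂.sink_label θ]
  · refine IsNodeFlow.glueAt hsm hmt
      ((h₁.node v hv).congr ?_ (fun _ _ => rfl) (fun _ _ _ => rfl) (fun _ _ _ => rfl)
        (fun _ _ _ => rfl) (fun _ _ => rfl))
      ((h₂.node v hv).congr ?_ (fun _ _ => rfl) (fun _ _ _ => rfl) (fun _ _ _ => rfl)
        (fun _ _ _ => rfl) (fun _ _ => rfl)) fun e => hq e
    · intro e θ hθ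
      simp only [FlowData.glueAt]
      rw [glueAt_of_le (hL _) hθ.2]
    · intro e θ hθ
      simp only [FlowData.glueAt]
      rw [glueAt_of_ge hθ.1]

theorem IsFlowOn.congr_inflow {B B' : V → ℝ → ℝ} {D : FlowData V E} {s t : ℝ}
    (h : N.IsFlowOn B D s t) (hB : ∀ v, ∀ θ ∈ Ico s t, B' v θ = B v θ) :
    N.IsFlowOn B' D s t :=
  ⟨h.sink_label, fun v hv => (h.node v hv).congr (fun _ _ _ => rfl) (hB v) (fun _ _ _ => rfl)
    (fun _ _ _ => rfl) (fun _ _ _ => rfl) fun _ _ => rfl⟩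

theorem IsFlowOn.queue_nonneg (hN : N.Acyclic) {B : V → ℝ → ℝ} {D : FlowData V E} {s t θ : ℝ}
    (h : N.IsFlowOn B D s t) (hθ : θ ∈ Icc s t) (e : E) : 0 ≤ D.queue e θ :=
  (h.node _ (hN.tail_ne_sink e)).queue_nonneg θ hθ ⟨e, rfl⟩

theorem IsFlowOn.outRate_nonneg (hN : N.Acyclic) {B : V → ℝ → ℝ} {D : FlowData V E}
    {s t θ : ℝ} (h : N.IsFlowOn B D s t) (hθ : θ ∈ Ico s t) (e : E) : 0 ≤ D.outRate e θ :=
  (h.node _ (hN.tail_ne_sink e)).outflow_nonneg (fun e => N.cap_pos e) hθ ⟨e, rfl⟩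

theorem IsFlowOn.piecewiseOn_queuePhase (hN : N.Acyclic) {B : V → ℝ → ℝ} {D : FlowData V E}
    {s t : ℝ} (h : N.IsFlowOn B D s t) (e : E) :
    PiecewiseOn (QueuePhase (D.inRate e) (D.outRate e) (D.queue e)) s t :=
  (h.node _ (hN.tail_ne_sink e)).queue ⟨e, rfl⟩

/-- An equilibrium flow up to time `T` can be prolonged by the minimal travel time. -/
theorem Acyclic.exists_extension (hN : N.Acyclic) {ε T : ℝ} (hε : 0 < ε)
    (hετ : ∀ e, ε ≤ N.time e) (hT : 0 ≤ T) {D : FlowData V E} (hD0 : ∀ e, D.queue e 0 = 0)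
    (hD : N.IsFlowOn (N.inflow D.outRate) D 0 T) :
    ∃ D', (∀ e, D'.queue e 0 = 0) ∧ N.IsFlowOn (N.inflow D'.outRate) D' 0 (T + ε) ∧
      ∀ θ < T, (∀ e, D'.inRate e θ = D.inRate e θ ∧ D'.outRate e θ = D.outRate e θ ∧
        D'.queue e θ = D.queue e θ) ∧ ∀ v, D'.label v θ = D.label v θ := by
  have hlt : T < T + ε := by linarith
  have hTT : T ∈ Icc 0 T := ⟨hT, le_rfl⟩
  obtain ⟨D₂, hq, hD₂⟩ := hN.exists_isFlowOn (B := N.inflow D.outRate) hlt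
    (fun v => (N.piecewiseOn_inflow hετ
      (fun e => (hD.piecewiseOn_queuePhase hN e).mono fun _ _ _ _ _ h => h.2.1) v).mono_interval
      hT le_rfl)
    (fun v θ hθ => N.inflow_nonneg (fun e he => hD.outRate_nonneg hN
      ⟨by linarith, by linarith [hθ.2, hετ e]⟩ e) v)
    (fun e => D.queue e T) (fun e => hD.queue_nonneg hN hTT e)
  refine ⟨D.glueAt T D₂, fun e => ?_,
    (hN.isFlowOn_glueAt hT hlt.le hD hD₂ fun e => (hq e).symm).congr_inflow fun v θ hθ => ?_,
    fun θ hθ => ⟨fun e => ⟨glueAt_of_lt hθ, glueAt_of_lt hθ, glueAt_of_lt hθ⟩,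
      fun v => glueAt_of_lt hθ⟩⟩
  · simp only [FlowData.glueAt]
    rw [glueAt_of_le (hq e).symm hT, hD0]
  · refine N.inflow_congr (fun e _ => glueAt_of_lt ?_) v
    linarith [hθ.2, hετ e]

/-- There is an equilibrium flow for all times. -/
theorem Acyclic.exists_isFlowOn_forall (hN : N.Acyclic) :
    ∃ D : FlowData V E, (∀ e, D.queue e 0 = 0) ∧
      ∀ T, N.IsFlowOn (N.inflow D.outRate) D 0 T := by
  obtain ⟨ε, hε, hετ⟩ : ∃ ε, 0 < ε ∧ ∀ e, ε ≤ N.time e := by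
    rcases isEmpty_or_nonempty E with h | h
    · exact ⟨1, one_pos, fun e => h.elim e⟩
    · obtain ⟨e₀, he₀⟩ := Finite.exists_min N.time
      exact ⟨_, N.time_pos e₀, he₀⟩
  have hpos : ∀ k : ℕ, 0 < (k + 1 : ℕ) * ε := fun k => by positivity
  obtain ⟨D₀, h₀⟩ : ∃ D : FlowData V E, (∀ e, D.queue e 0 = 0) ∧
      N.IsFlowOn (N.inflow D.outRate) D 0 ((0 + 1 : ℕ) * ε) := by
    obtain ⟨D, hq, hD⟩ := hN.exists_isFlowOn (B := N.inflow fun _ _ => 0) (hpos 0)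
      (fun v => (N.piecewiseOn_inflow (t := 0) hετ (fun e => ⟨∅, fun _ _ _ _ _ _ _ _ => rfl⟩)
        v).mono_interval le_rfl (by simp))
      (fun v θ _ => N.inflow_nonneg (fun e _ => le_rfl) v) (fun _ => 0) fun _ => le_rfl
    refine ⟨D, hq, hD.congr_inflow fun v θ hθ => N.inflow_congr (fun e he => ?_) v⟩
    have := hθ.2
    simp only [zero_add, Nat.cast_one, one_mul] at this
    linarith [hετ e]
  have hstep : ∀ (k : ℕ) (D : FlowData V E), ((∀ e, D.queue e 0 = 0) ∧
      N.IsFlowOn (N.inflow D.outRate) D 0 ((k + 1 : ℕ) * ε)) → ∃ D' : FlowData V E,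
      ((∀ e, D'.queue e 0 = 0) ∧
      N.IsFlowOn (N.inflow D'.outRate) D' 0 ((k + 1 + 1 : ℕ) * ε)) ∧
      ∀ θ < (k + 1 : ℕ) * ε, (∀ e, D'.inRate e θ = D.inRate e θ ∧
        D'.outRate e θ = D.outRate e θ ∧ D'.queue e θ = D.queue e θ) ∧
        ∀ v, D'.label v θ = D.label v θ := by
    rintro k D ⟨hq, hD⟩
    obtain ⟨D', h1, h2, h3⟩ := hN.exists_extension hε hετ (hpos k).le hq hD
    refine ⟨D', ⟨h1, ?_⟩, h3⟩
    rwa [show ((k + 1 + 1 : ℕ) : ℝ) * ε = (k + 1 : ℕ) * ε + ε by push_cast; ring]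
  choose! next hnext hagree using hstep
  let F : ℕ → FlowData V E := fun k => Nat.rec D₀ next k
  have hF : ∀ k, (∀ e, (F k).queue e 0 = 0) ∧
      N.IsFlowOn (N.inflow (F k).outRate) (F k) 0 ((k + 1 : ℕ) * ε) := by
    intro k
    induction k with
    | zero => exact h₀
    | succ k ih => exact hnext k _ ih
  have hmono : ∀ j k : ℕ, j ≤ k → ∀ θ < (j + 1 : ℕ) * ε,
      (∀ e, (F k).inRate e θ = (F j).inRate e θ ∧ (F k).outRate e θ = (F j).outRate e θ ∧
        (F k).queue e θ = (F j).queue e θ) ∧ ∀ v, (F k).label v θ = (F j).label v θ := by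
    intro j k hjk θ hθ
    induction k, hjk using Nat.le_induction with
    | base => exact ⟨fun e => ⟨rfl, rfl, rfl⟩, fun v => rfl⟩
    | succ k hjk ih =>
      have hθ' : θ < (k + 1 : ℕ) * ε := hθ.trans_le
        (mul_le_mul_of_nonneg_right (by exact_mod_cast Nat.succ_le_succ hjk) hε.le)
      obtain ⟨h1, h2⟩ := hagree k (F k) (hF k) θ hθ'
      refine ⟨fun e => ?_, fun v => (h2 v).trans (ih.2 v)⟩
      obtain ⟨h3, h4, h5⟩ := h1 e
      obtain ⟨h6, h7, h8⟩ := ih.1 e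
      exact ⟨h3.trans h6, h4.trans h7, h5.trans h8⟩
  let κ : ℝ → ℕ := fun θ => ⌊θ / ε⌋₊
  have hκ : ∀ θ, θ < (κ θ + 1 : ℕ) * ε := fun θ => by
    have := Nat.lt_floor_add_one (θ / ε)
    rw [div_lt_iff₀ hε] at this
    exact_mod_cast this
  let D : FlowData V E :=
    { inRate := fun e θ => (F (κ θ)).inRate e θ
      outRate := fun e θ => (F (κ θ)).outRate e θ
      queue := fun e θ => (F (κ θ)).queue e θ
      label := fun v θ => (F (κ θ)).label v θ }
  have hD : ∀ k θ, θ < (k + 1 : ℕ) * ε →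
      (∀ e, D.inRate e θ = (F k).inRate e θ ∧ D.outRate e θ = (F k).outRate e θ ∧
        D.queue e θ = (F k).queue e θ) ∧ ∀ v, D.label v θ = (F k).label v θ := by
    intro k θ hθ
    rcases le_total (κ θ) k with h | h
    · obtain ⟨h1, h2⟩ := hmono _ _ h θ (hκ θ)
      exact ⟨fun e => ⟨(h1 e).1.symm, (h1 e).2.1.symm, (h1 e).2.2.symm⟩, fun v => (h2 v).symm⟩
    · exact hmono _ _ h θ hθ
  refine ⟨D, fun e => (hF (κ 0)).1 e, fun T => ⟨fun θ => (hF (κ θ)).2.sink_label θ, fun v hv => ?_⟩⟩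
  have hT : ∀ θ ≤ T, θ < (κ T + 1 : ℕ) * ε := fun θ hθ => hθ.trans_lt (hκ T)
  refine (((hF (κ T)).2.node v hv).mono_interval le_rfl (hκ T).le).congr ?_ ?_ ?_ ?_ ?_ ?_
  · intro e θ hθ
    exact congrArg _ ((hD _ θ (hT θ hθ.2)).2 _)
  · exact fun θ hθ => N.inflow_congr (fun e _ => ((hD _ _ (hT _ (by
      linarith [hθ.2, N.time_pos e]))).1 e).2.1) v
  · exact fun e θ hθ => ((hD _ θ (hT θ hθ.2.le)).1 e).1
  · exact fun e θ hθ => ((hD _ θ (hT θ hθ.2.le)).1 e).2.1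
  · exact fun e θ hθ => ((hD _ θ (hT θ hθ.2)).1 e).2.2
  · exact fun θ hθ => (hD _ θ (hT θ hθ.2)).2 v

end Network

/-! ### Integrals of piecewise constant rates -/

theorem ConstIco.intervalIntegrable {g : ℝ → ℝ} {a b : ℝ} (h : ConstIco g a b) (hab : a ≤ b) :
    IntervalIntegrable g volume a b := by
  refine (intervalIntegrable_const (c := g a)).congr_uIoo fun θ hθ => ?_
  rw [uIoo_of_le hab] at hθ
  exact (h θ (Ioo_subset_Ico_self hθ)).symm

theorem ConstIco.integral_eq {g : ℝ → ℝ} {a b : ℝ} (h : ConstIco g a b) (hab : a ≤ b) :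
    ∫ θ in a..b, g θ = g a * (b - a) := by
  rw [intervalIntegral.integral_congr_Ioo_of_le (g := fun _ => g a) hab
    fun θ hθ => h θ (Ioo_subset_Ico_self hθ), intervalIntegral.integral_const, smul_eq_mul,
    mul_comm]

theorem ConstIco.aeConstOn {g : ℝ → ℝ} {a b : ℝ} (h : ConstIco g a b) :
    AEConstOn g (Ioo a b) :=
  ⟨g a, ae_restrict_of_forall_mem measurableSet_Ioo fun θ hθ => h θ (Ioo_subset_Ico_self hθ)⟩

/-- The queue grows by the difference between the cumulative rates. -/
theorem PiecewiseOn.integral_sub_integral {x y q : ℝ → ℝ} {s t : ℝ} (hst : s ≤ t)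
    (h : PiecewiseOn (QueuePhase x y q) s t) :
    IntervalIntegrable x volume s t ∧ IntervalIntegrable y volume s t ∧
      (∫ θ in s..t, x θ) - ∫ θ in s..t, y θ = q t - q s := by
  rcases hst.eq_or_lt with rfl | hst
  · simp
  refine h.induction (Q := fun s t => IntervalIntegrable x volume s t ∧
    IntervalIntegrable y volume s t ∧ (∫ θ in s..t, x θ) - ∫ θ in s..t, y θ = q t - q s) hst ?_ ?_
  · rintro a b - hab - ⟨hx, hy, hq⟩
    refine ⟨hx.intervalIntegrable hab.le, hy.intervalIntegrable hab.le, ?_⟩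
    rw [hx.integral_eq hab.le, hy.integral_eq hab.le, hq b ⟨hab.le, le_rfl⟩]
    ring
  · rintro a m b - - - - ⟨hx₁, hy₁, hq₁⟩ ⟨hx₂, hy₂, hq₂⟩
    refine ⟨hx₁.trans hx₂, hy₁.trans hy₂, ?_⟩
    rw [← intervalIntegral.integral_add_adjacent_intervals hx₁ hx₂,
      ← intervalIntegral.integral_add_adjacent_intervals hy₁ hy₂]
    linarith

theorem delayed_of_lt {τ θ : ℝ} {y : ℝ → ℝ} (h : θ < τ) : delayed τ y θ = 0 :=
  if_neg h.not_ge

theorem delayed_of_le {τ θ : ℝ} {y : ℝ → ℝ} (h : τ ≤ θ) : delayed τ y θ = y (θ - τ) :=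
  if_pos h

theorem delayed_nonneg {τ : ℝ} {y : ℝ → ℝ} (h : ∀ θ, 0 ≤ θ → 0 ≤ y θ) (θ : ℝ) :
    0 ≤ delayed τ y θ := by
  unfold delayed
  split_ifs with hθ
  exacts [h _ (sub_nonneg.2 hθ), le_rfl]

theorem delayed_eventually_eq_zero {τ : ℝ} {y : ℝ → ℝ} (h : ∀ᶠ θ in Filter.atTop, y θ = 0) :
    ∀ᶠ θ in Filter.atTop, delayed τ y θ = 0 := by
  filter_upwards [(Filter.tendsto_atTop_add_const_right _ (-τ) Filter.tendsto_id).eventually h]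
    with θ hθ
  rcases lt_or_ge θ τ with h | h
  · exact delayed_of_lt h
  · rw [delayed_of_le h, sub_eq_add_neg]
    exact hθ

theorem integral_delayed {τ θ : ℝ} {y : ℝ → ℝ} (hτ : 0 ≤ τ)
    (h : ∀ θ, 0 ≤ θ → IntervalIntegrable y volume 0 θ) :
    IntervalIntegrable (delayed τ y) volume 0 θ ∧
      (τ ≤ θ → ∫ ζ in (0 : ℝ)..θ, delayed τ y ζ = ∫ ζ in (0 : ℝ)..(θ - τ), y ζ) := by
  have hsmall : ∀ {θ}, θ ≤ τ → EqOn (fun _ => (0 : ℝ)) (delayed τ y) (uIoo 0 θ) :=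
    fun {θ} hθ ζ hζ => (delayed_of_lt (hζ.2.trans_le (max_le hτ hθ))).symm
  rcases le_or_gt θ τ with hθ | hθ
  · refine ⟨intervalIntegrable_const.congr_uIoo (hsmall hθ), fun h => ?_⟩
    obtain rfl := le_antisymm hθ h
    rw [← intervalIntegral.integral_congr_uIoo (hsmall hθ)]
    simp
  · have hlarge : EqOn (fun ζ => y (ζ - τ)) (delayed τ y) (uIoo τ θ) := by
      rw [uIoo_of_le hθ.le]
      exact fun ζ hζ => (delayed_of_le hζ.1.le).symm
    have h₁ : IntervalIntegrable (delayed τ y) volume 0 τ :=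
      intervalIntegrable_const.congr_uIoo (hsmall le_rfl)
    have h₂ : IntervalIntegrable (delayed τ y) volume τ θ := by
      have := (h (θ - τ) (sub_nonneg.2 hθ.le)).comp_sub_right τ
      rw [zero_add, sub_add_cancel] at this
      exact this.congr_uIoo hlarge
    refine ⟨h₁.trans h₂, fun _ => ?_⟩
    rw [← intervalIntegral.integral_add_adjacent_intervals h₁ h₂,
      ← intervalIntegral.integral_congr_uIoo (hsmall le_rfl),
      ← intervalIntegral.integral_congr_uIoo hlarge, intervalIntegral.integral_comp_sub_right]
    simp

/-! ### Shortest walks -/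

namespace Network

variable {N : Network V E}

/-- Potentials satisfying the Bellman equations are the minimal costs of walks to the sink. -/
theorem Acyclic.isLeast_walk_cost (hN : N.Acyclic) {c : E → ℝ} {ℓ : V → ℝ}
    (hsink : ℓ N.sink = 0) (hle : ∀ e, ℓ (N.tail e) ≤ c e + ℓ (N.head e))
    (heq : ∀ v, v ≠ N.sink → ∃ e, N.tail e = v ∧ ℓ v = c e + ℓ (N.head e)) (v : V) :
    IsLeast {r : ℝ | ∃ L : List E, IsWalk N.tail N.head v N.sink L ∧ r = (L.map c).sum}
      (ℓ v) := by
  constructor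
  · induction hn : N.rank v using Nat.strong_induction_on generalizing v with
    | _ n ih =>
    by_cases hv : v = N.sink
    · exact ⟨[], hv, by simp [hv, hsink]⟩
    · obtain ⟨e, rfl, he⟩ := heq v hv
      obtain ⟨L, hL, hr⟩ := ih _ (hn ▸ hN.rank_head_lt e) _ rfl
      exact ⟨e :: L, ⟨rfl, hL⟩, by rw [he, hr, List.map_cons, List.sum_cons]⟩
  · rintro _ ⟨L, hL, rfl⟩
    induction L generalizing v with
    | nil => rw [show v = N.sink from hL]; simp [hsink]
    | cons e L ih =>
      obtain ⟨rfl, hL⟩ := hL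
      rw [List.map_cons, List.sum_cons]
      linarith [hle e, ih _ hL]

/-! ### Properties of equilibrium flows on all of time -/

/-- The flow data `D` describe an equilibrium flow at all times. -/
structure IsFlow (N : Network V E) (D : FlowData V E) : Prop where
  acyclic : N.Acyclic
  queue_zero : ∀ e, D.queue e 0 = 0
  isFlowOn : ∀ T, N.IsFlowOn (N.inflow D.outRate) D 0 T

namespace IsFlow

variable {D : FlowData V E} {θ : ℝ}

theorem isFlowAt (h : N.IsFlow D) (e : E) (T : ℝ) :
    N.IsFlowAt (N.inflow D.outRate) D 0 T (N.tail e) :=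
  (h.isFlowOn T).node _ (h.acyclic.tail_ne_sink e)

theorem piecewiseOn_queuePhase (h : N.IsFlow D) (e : E) {s : ℝ} (hs : 0 ≤ s) (t : ℝ) :
    PiecewiseOn (QueuePhase (D.inRate e) (D.outRate e) (D.queue e)) s t :=
  ((h.isFlowOn t).piecewiseOn_queuePhase h.acyclic e).mono_interval hs le_rfl

theorem inRate_nonneg (h : N.IsFlow D) (hθ : 0 ≤ θ) (e : E) : 0 ≤ D.inRate e θ :=
  (h.isFlowAt e (θ + 1)).nonneg θ ⟨hθ, by linarith⟩ ⟨e, rfl⟩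

theorem outRate_nonneg (h : N.IsFlow D) (hθ : 0 ≤ θ) (e : E) : 0 ≤ D.outRate e θ :=
  (h.isFlowOn (θ + 1)).outRate_nonneg h.acyclic ⟨hθ, by linarith⟩ e

theorem queue_nonneg (h : N.IsFlow D) (hθ : 0 ≤ θ) (e : E) : 0 ≤ D.queue e θ :=
  (h.isFlowOn θ).queue_nonneg h.acyclic ⟨hθ, le_rfl⟩ e

theorem sum_inRate (h : N.IsFlow D) (hθ : 0 ≤ θ) {v : V} (hv : v ≠ N.sink) :
    ∑ e ∈ N.outEdges v, D.inRate e θ = N.inflow D.outRate v θ := by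
  rw [← ((h.isFlowOn (θ + 1)).node v hv).sum_eq θ ⟨hθ, by linarith⟩]
  exact Finset.sum_subtype _ (fun e => by simp [outEdges]) _

theorem outRate_eq (h : N.IsFlow D) (hθ : 0 ≤ θ) (e : E) :
    D.outRate e θ = if 0 < D.queue e θ then N.cap e else min (D.inRate e θ) (N.cap e) :=
  (h.isFlowAt e (θ + 1)).outflow θ ⟨hθ, by linarith⟩ ⟨e, rfl⟩

theorem label_eq_of_pos (h : N.IsFlow D) (hθ : 0 ≤ θ) {e : E} (he : 0 < D.inRate e θ) :
    D.label (N.tail e) θ =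
      N.time e + D.queue e θ / N.cap e + D.label (N.head e) θ := by
  rw [(h.isFlowAt e (θ + 1)).active θ ⟨hθ, by linarith⟩ ⟨e, rfl⟩ he]
  ring

theorem isLeast_label (h : N.IsFlow D) (hθ : 0 ≤ θ) (v : V) :
    IsLeast {r : ℝ | ∃ L : List E, IsWalk N.tail N.head v N.sink L ∧
      r = (L.map fun e => N.time e + D.queue e θ / N.cap e).sum} (D.label v θ) := by
  refine h.acyclic.isLeast_walk_cost (ℓ := fun v => D.label v θ)
    ((h.isFlowOn θ).sink_label θ) (fun e => ?_) (fun v hv => ?_) v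
  · have := (h.isFlowAt e θ).label_le θ ⟨hθ, le_rfl⟩ ⟨e, rfl⟩
    linarith
  · obtain ⟨e, he⟩ := ((h.isFlowOn θ).node v hv).label_eq θ ⟨hθ, le_rfl⟩
    exact ⟨e, e.2, by rw [he]; ring⟩

theorem intervalIntegrable_inRate (h : N.IsFlow D) (e : E) (hθ : 0 ≤ θ) :
    IntervalIntegrable (D.inRate e) volume 0 θ :=
  ((h.piecewiseOn_queuePhase e le_rfl θ).integral_sub_integral hθ).1

theorem intervalIntegrable_outRate (h : N.IsFlow D) (e : E) (hθ : 0 ≤ θ) :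
    IntervalIntegrable (D.outRate e) volume 0 θ :=
  ((h.piecewiseOn_queuePhase e le_rfl θ).integral_sub_integral hθ).2.1

theorem queueOf_eq (h : N.IsFlow D) (hθ : 0 ≤ θ) (e : E) :
    queueOf N (fun e => delayed 0 (D.inRate e)) (fun e => delayed (N.time e) (D.outRate e)) e θ =
      D.queue e θ := by
  unfold queueOf
  rw [(integral_delayed le_rfl fun _ => h.intervalIntegrable_inRate e).2 hθ,
    (integral_delayed (N.time_pos e).le fun _ => h.intervalIntegrable_outRate e).2 (by linarith),
    sub_zero, add_sub_cancel_right,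
    ((h.piecewiseOn_queuePhase e le_rfl θ).integral_sub_integral hθ).2.2, h.queue_zero, sub_zero]

theorem ctimeOf_eq (h : N.IsFlow D) (hθ : 0 ≤ θ) (e : E) :
    ctimeOf N (fun e => delayed 0 (D.inRate e)) (fun e => delayed (N.time e) (D.outRate e)) e θ =
      N.time e + D.queue e θ / N.cap e := by
  rw [ctimeOf, h.queueOf_eq hθ]

theorem labelOf_eq (h : N.IsFlow D) (hθ : 0 ≤ θ) (v : V) :
    labelOf N (fun e => delayed 0 (D.inRate e)) (fun e => delayed (N.time e) (D.outRate e)) v θ =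
      D.label v θ := by
  unfold labelOf
  simp only [h.ctimeOf_eq hθ]
  exact (h.isLeast_label hθ v).csInf_eq

/-- The flow over time given by the flow data `D`. -/
noncomputable def toFlowOverTime (h : N.IsFlow D) : FlowOverTime N where
  fplus e := delayed 0 (D.inRate e)
  fminus e := delayed (N.time e) (D.outRate e)
  fplus_nonneg e := delayed_nonneg fun _ hθ => h.inRate_nonneg hθ e
  fminus_nonneg e := delayed_nonneg fun _ hθ => h.outRate_nonneg hθ e
  fplus_int e _ := (integral_delayed le_rfl fun _ => h.intervalIntegrable_inRate e).1
  fminus_int e _ := (integral_delayed (N.time_pos e).le fun _ =>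
    h.intervalIntegrable_outRate e).1

theorem isIDE (h : N.IsFlow D) : IsIDE N h.toFlowOverTime := by
  have hx : ∀ {θ}, 0 ≤ θ → ∀ e, h.toFlowOverTime.fplus e θ = D.inRate e θ := fun hθ e =>
    (delayed_of_le hθ).trans (by rw [sub_zero])
  refine ⟨⟨fun v hv θ hθ => ?_, fun θ hθ => ?_, fun e θ _ hθ => delayed_of_lt hθ,
    fun e θ hθ => ?_⟩, fun e θ hθ he => ?_⟩
  · rw [Finset.sum_congr rfl fun e _ => hx hθ e, h.sum_inRate hθ hv]
    exact add_sub_cancel_right _ _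
  · have : N.outEdges N.sink = ∅ :=
      Finset.filter_eq_empty_iff.2 fun e _ => h.acyclic.tail_ne_sink e
    rw [this, Finset.sum_empty, zero_sub, neg_nonpos]
    exact Finset.sum_nonneg fun e _ => h.toFlowOverTime.fminus_nonneg e θ
  · rw [hx hθ]
    refine (delayed_of_le (by linarith)).trans ?_
    rw [add_sub_cancel_right, h.outRate_eq hθ]
    exact congrArg (fun q => if 0 < q then N.cap e else min (D.inRate e θ) (N.cap e))
      (h.queueOf_eq hθ e).symm
  · rw [hx hθ] at he
    refine (h.labelOf_eq hθ _).trans ((h.label_eq_of_pos hθ he).trans ?_)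
    exact congrArg₂ _ (h.ctimeOf_eq hθ e).symm (h.labelOf_eq hθ _).symm

/-! ### Termination -/

/-- An edge that is no longer entered runs empty. -/
theorem eventually_outRate_eq_zero (h : N.IsFlow D) {e : E}
    (he : ∀ᶠ θ in Filter.atTop, D.inRate e θ = 0) :
    ∀ᶠ θ in Filter.atTop, D.outRate e θ = 0 := by
  obtain ⟨T, hT⟩ := Filter.eventually_atTop.1
    (he.and (Filter.eventually_ge_atTop (0 : ℝ)))
  have hT0 : 0 ≤ T := (hT T le_rfl).2
  have hν := N.cap_pos e
  have hq : ∀ {s t}, T ≤ s → s ≤ t → D.queue e t = D.queue e s - ∫ θ in s..t, D.outRate e θ := by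
    intro s t hs hst
    have h₁ := ((h.piecewiseOn_queuePhase e (hT0.trans hs) t).integral_sub_integral hst).2.2
    have h₂ : ∫ θ in s..t, D.inRate e θ = 0 := by
      rw [intervalIntegral.integral_congr_Ioo_of_le (g := fun _ => (0 : ℝ)) hst fun θ hθ =>
        (hT θ (hs.trans hθ.1.le)).1, intervalIntegral.integral_zero]
    linarith
  obtain ⟨s, hs, hqs⟩ : ∃ s, T ≤ s ∧ D.queue e s = 0 := by
    by_contra! hne
    have hpos : ∀ s, T ≤ s → 0 < D.queue e s := fun s hs =>
      (h.queue_nonneg (hT0.trans hs) e).lt_of_ne' (hne s hs)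
    have hlt : T < T + D.queue e T / N.cap e := by
      have := div_pos (hpos T le_rfl) hν
      linarith
    refine hne _ hlt.le ?_
    rw [hq le_rfl hlt.le, intervalIntegral.integral_congr_Ioo_of_le (g := fun _ => N.cap e) hlt.le
      fun θ hθ => (h.outRate_eq (hT0.trans hθ.1.le) e).trans (if_pos (hpos θ hθ.1.le)),
      intervalIntegral.integral_const, smul_eq_mul, add_sub_cancel_left,
      div_mul_cancel₀ _ hν.ne', sub_self]
  filter_upwards [Filter.eventually_ge_atTop s] with θ hθ
  have hout : 0 ≤ ∫ ζ in s..θ, D.outRate e ζ :=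
    intervalIntegral.integral_nonneg hθ fun ζ hζ =>
      h.outRate_nonneg (hT0.trans (hs.trans hζ.1)) e
  have hqθ : ¬ 0 < D.queue e θ := by
    rw [hq hs hθ, hqs]
    linarith
  rw [h.outRate_eq (hT0.trans (hs.trans hθ)), if_neg hqθ, (hT θ (hs.trans hθ)).1,
    min_eq_left hν.le]

theorem eventually_inRate_eq_zero (h : N.IsFlow D) {e : E}
    (he : ∀ᶠ θ in Filter.atTop, N.inflow D.outRate (N.tail e) θ = 0) :
    ∀ᶠ θ in Filter.atTop, D.inRate e θ = 0 := by
  filter_upwards [he, Filter.eventually_ge_atTop (0 : ℝ)] with θ hθ h0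
  rw [← h.sum_inRate h0 (h.acyclic.tail_ne_sink e)] at hθ
  exact (Finset.sum_eq_zero_iff_of_nonneg fun e _ => h.inRate_nonneg h0 e).1 hθ e
    (by simp [outEdges])

theorem eventually_inflow_eq_zero (h : N.IsFlow D) (hN : N.BddInflow) (v : V) :
    ∀ᶠ θ in Filter.atTop, N.inflow D.outRate v θ = 0 := by
  induction hn : Nat.card V - N.rank v using Nat.strong_induction_on generalizing v with
  | _ n ih =>
  have hu : ∀ᶠ θ in Filter.atTop, N.u v θ = 0 := Filter.eventually_atTop.2 (hN v)
  have hd : ∀ᶠ θ in Filter.atTop, ∀ e ∈ N.inEdges v,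
      delayed (N.time e) (D.outRate e) θ = 0 := by
    rw [Filter.eventually_all_finset]
    intro e he
    have hev : N.head e = v := (Finset.mem_filter.1 he).2
    refine delayed_eventually_eq_zero (h.eventually_outRate_eq_zero
      (h.eventually_inRate_eq_zero (ih _ ?_ _ rfl)))
    have h₁ := h.acyclic.rank_head_lt e
    have h₂ : N.rank (N.tail e) ≤ Nat.card V := ncard_le_card _
    rw [hev] at h₁
    omega
  filter_upwards [hu, hd] with θ h₁ h₂
  rw [inflow, h₁, Finset.sum_eq_zero h₂, add_zero]

end IsFlow

end Network

/-! ### Phases -/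

theorem PiecewiseOn.exists_partition {P : ℝ → ℝ → Prop} {s t : ℝ} (h : PiecewiseOn P s t)
    (hst : s < t) : ∃ (n : ℕ) (τ : ℕ → ℝ), τ 0 = s ∧ τ n = t ∧
      ∀ i < n, τ i < τ (i + 1) ∧ P (τ i) (τ (i + 1)) := by
  refine h.induction (Q := fun s t => ∃ (n : ℕ) (τ : ℕ → ℝ), τ 0 = s ∧ τ n = t ∧
    ∀ i < n, τ i < τ (i + 1) ∧ P (τ i) (τ (i + 1))) hst ?_ ?_
  · intro a b _ hab _ hP
    refine ⟨1, fun i => if i = 0 then a else b, rfl, rfl, fun i hi => ?_⟩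
    obtain rfl : i = 0 := by omega
    exact ⟨hab, hP⟩
  · rintro a m b - - - - ⟨n₁, τ₁, ha, hm, h₁⟩ ⟨n₂, τ₂, hm', hb, h₂⟩
    have hlo : ∀ i ≤ n₁, (if i < n₁ then τ₁ i else τ₂ (i - n₁)) = τ₁ i := by
      intro i hi
      split_ifs with h
      · rfl
      · obtain rfl : i = n₁ := by omega
        rw [Nat.sub_self, hm', hm]
    have hhi : ∀ i, n₁ ≤ i → (if i < n₁ then τ₁ i else τ₂ (i - n₁)) = τ₂ (i - n₁) :=
      fun i hi => if_neg hi.not_gt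
    refine ⟨n₁ + n₂, fun i => if i < n₁ then τ₁ i else τ₂ (i - n₁), (hlo 0 n₁.zero_le).trans ha,
      (hhi _ (Nat.le_add_right _ _)).trans (by rw [Nat.add_sub_cancel_left, hb]), fun i hi => ?_⟩
    rcases lt_or_ge i n₁ with hi' | hi'
    · simp only [hlo i hi'.le, hlo (i + 1) hi']
      exact h₁ i hi'
    · simp only [hhi i hi', hhi (i + 1) (hi'.trans i.le_succ)]
      rw [Nat.sub_add_comm hi']
      exact h₂ (i - n₁) (by omega)

theorem Network.IsFlow.exists_phasePartition {N : Network V E} {D : FlowData V E}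
    (h : N.IsFlow D) (hN : N.BddInflow) :
    ∃ (n : ℕ) (t : ℕ → ℝ), PhasePartition N h.toFlowOverTime n t := by
  have hzero : ∀ᶠ θ in Filter.atTop, ∀ e, h.toFlowOverTime.fplus e θ = 0 ∧
      h.toFlowOverTime.fminus e θ = 0 := by
    refine Filter.eventually_all.2 fun e => ?_
    have hx := h.eventually_inRate_eq_zero (h.eventually_inflow_eq_zero hN (N.tail e))
    exact (delayed_eventually_eq_zero hx).and
      (delayed_eventually_eq_zero (h.eventually_outRate_eq_zero hx))
  obtain ⟨T, hT⟩ := Filter.eventually_atTop.1 (hzero.and (Filter.eventually_gt_atTop (0 : ℝ)))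
  have hconst : PiecewiseOn (fun a b => ∀ e, ConstIco (h.toFlowOverTime.fplus e) a b ∧
      ConstIco (h.toFlowOverTime.fminus e) a b) 0 T := by
    refine PiecewiseOn.forall_of_finite fun e => PiecewiseOn.and ?_ ?_
    · exact (((h.piecewiseOn_queuePhase e le_rfl T).mono fun _ _ _ _ _ hp =>
        hp.1).constIco_delayed (τ := 0)).mono_interval le_rfl (by linarith)
    · exact (((h.piecewiseOn_queuePhase e le_rfl T).mono fun _ _ _ _ _ hp =>
        hp.2.1).constIco_delayed (τ := N.time e)).mono_interval le_rfl
          (by linarith [N.time_pos e])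
  obtain ⟨n, t, h0, hn, ht⟩ := hconst.exists_partition (hT T le_rfl).2
  refine ⟨n, t, h0, fun i hi => (ht i hi).1, fun i _ e => ?_⟩
  unfold phaseSeg
  split_ifs with hi
  · exact ⟨((ht i hi).2 e).1.aeConstOn, ((ht i hi).2 e).2.aeConstOn⟩
  · rw [hn]
    exact ⟨⟨0, ae_restrict_of_forall_mem measurableSet_Ioi fun θ hθ => ((hT θ hθ.le).1 e).1⟩,
      ⟨0, ae_restrict_of_forall_mem measurableSet_Ioi fun θ hθ => ((hT θ hθ.le).1 e).2⟩⟩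

/-- Every single-sink network on an acyclic directed graph (with
right-constant piecewise constant inflow rates with finitely many jump points and
bounded support) admits an IDE flow with only finitely many phases; in particular all
edge in- and outflow rates of this IDE are piecewise constant with finitely many pieces. -/
theorem ide_with_finitely_many_phases_acyclic
    {V E : Type} [Fintype V] [DecidableEq V] [Fintype E] [DecidableEq E]
    (N : Network V E) (hacyc : N.Acyclic) (hbdd : N.BddInflow) :
    ∃ f : FlowOverTime N, IsIDE N f ∧ ∃ (n : ℕ) (t : ℕ → ℝ), PhasePartition N f n t := by
  obtain ⟨D, hD0, hD⟩ := hacyc.exists_isFlowOn_forall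
  have h : N.IsFlow D := ⟨hacyc, hD0, hD⟩
  exact ⟨h.toFlowOverTime, h.isIDE, h.exists_phasePartition hbdd⟩
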